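/- Let G be a Borel graph on a standard Borel space X all of whose vertices have degree at most d, where d ≥ 3 is a natural number, and suppose G contains no complete subgraph on d+1 vertices (i.e. no d+1 pairwise adjacent vertices). Then for every Borel probability measure μ on X, G admits a μ-measurable proper d-coloring, i.e. a μ-measurable map c : X → {0,…,d−1} with c(x) ≠ c(y) whenever x and y are adjacent. -/

import Mathlib

open MeasureTheory

/-- A partial function `f : B → X` is *one-ended* if there is no infinite sequence
`x₀, x₁, x₂, …` of points of `B` with `f (x_{i+1}) = x_i` for all `i`. -/
def OneEnded {X : Type*} {B : Set X} (f : B → X) : Prop :=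
  ¬ ∃ u : ℕ → B, ∀ i : ℕ, f (u (i + 1)) = (u i : X)

/-- A set of vertices is `G`-invariant if it is a union of connected components of `G`. -/
def GraphInvariant {X : Type*} (G : SimpleGraph X) (A : Set X) : Prop :=
  ∀ ⦃x y : X⦄, G.Reachable x y → x ∈ A → y ∈ A

/-- `[A]_{E_G}`: the union of all connected components of `G` meeting `A`. -/
def EGSat {X : Type*} (G : SimpleGraph X) (A : Set X) : Set X :=
  {x | ∃ a ∈ A, G.Reachable x a}

/-- `S` is biconnected: the induced subgraph on `S` is connected and remains connected
(in the sense of `Preconnected`) after deleting any single vertex of `S`. -/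
def BiconnectedSet {X : Type*} (G : SimpleGraph X) (S : Set X) : Prop :=
  (G.induce S).Connected ∧ ∀ x ∈ S, (G.induce (S \ {x})).Preconnected

/-- A block of `G` is a maximal biconnected set. -/
def GraphBlock {X : Type*} (G : SimpleGraph X) (S : Set X) : Prop :=
  BiconnectedSet G S ∧ ∀ T : Set X, BiconnectedSet G T → S ⊆ T → T = S

/-- The induced subgraph on `S` is a cycle of odd length. -/
def OddCycleSet {X : Type*} (G : SimpleGraph X) (S : Set X) : Prop :=
  ∃ n : ℕ, Odd n ∧ 3 ≤ n ∧ Nonempty (G.induce S ≃g SimpleGraph.cycleGraph n)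

/-- A Gallai tree is a connected graph each of whose blocks induces a complete
graph or an odd cycle. -/
def GallaiTree {X : Type*} (G : SimpleGraph X) : Prop :=
  G.Connected ∧ ∀ S : Set X, GraphBlock G S → G.IsClique S ∨ OddCycleSet G S

/-- A graph is ample if every vertex has degree at least 2 and for every vertex `x`,
every connected component of the restriction of `G` to the complement of `{x}`
contains a vertex of degree at least 3 in that restriction. -/
def AmpleGraph {X : Type*} (G : SimpleGraph X) : Prop :=
  (∀ x : X, 2 ≤ (G.neighborSet x).encard) ∧
  ∀ x : X, ∀ y : ({x}ᶜ : Set X), ∃ z : ({x}ᶜ : Set X),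
    (G.induce ({x}ᶜ : Set X)).Reachable y z ∧
      3 ≤ ((G.induce ({x}ᶜ : Set X)).neighborSet z).encard

/-- `x E^even_G y`: `x` and `y` are joined by a path of even length in `G`. -/
def EvenRel {X : Type*} (G : SimpleGraph X) (x y : X) : Prop :=
  ∃ p : G.Walk x y, p.IsPath ∧ Even p.length

/-- A set is `E^even_G`-invariant if it is a union of `E^even_G`-classes. -/
def EvenInvariant {X : Type*} (G : SimpleGraph X) (C : Set X) : Prop :=
  ∀ ⦃x y : X⦄, EvenRel G x y → x ∈ C → y ∈ C

namespace MeasurableBrooks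

/-- If the sections of a Borel set have at most `d` points, then the set of base points whose
section has at least `k` points is Borel. -/
lemma measurableSet_exists_injective {X Y : Type*} [MeasurableSpace X] [StandardBorelSpace X]
    [MeasurableSpace Y] [StandardBorelSpace Y] {P : X → Y → Prop}
    (hP : MeasurableSet {p : X × Y | P p.1 p.2}) (d : ℕ)
    (hd : ∀ x, ¬ ∃ y : Fin (d + 1) → Y, Function.Injective y ∧ ∀ i, P x (y i)) (k : ℕ) :
    MeasurableSet {x | ∃ y : Fin k → Y, Function.Injective y ∧ ∀ i, P x (y i)} := by
  suffices H : ∀ j k, d + 1 ≤ k + j →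
      MeasurableSet {x | ∃ y : Fin k → Y, Function.Injective y ∧ ∀ i, P x (y i)} from
    H (d + 1) k (by omega)
  intro j
  induction j with
  | zero =>
    intro k hk
    convert MeasurableSet.empty
    ext x
    simp only [Set.mem_empty_iff_false, iff_false]
    rintro ⟨y, hy, hyP⟩
    exact hd x ⟨y ∘ Fin.castLE hk, hy.comp (Fin.castLE_injective hk), fun i => hyP _⟩
  | succ j ih =>
    intro k hk
    have hQ := ih (k + 1) (by omega)
    set Q := {x | ∃ y : Fin (k + 1) → Y, Function.Injective y ∧ ∀ i, P x (y i)} with hQdef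
    obtain ⟨e, he⟩ := exists_measurableEmbedding_real Y
    let Z : (Fin k → ℚ × ℚ) → Set (X × (Fin k → Y)) := fun I =>
      {p | p.1 ∉ Q ∧ ∀ i, P p.1 (p.2 i) ∧ e (p.2 i) ∈ Set.Ioo ((I i).1 : ℝ) ((I i).2 : ℝ)}
    have hZ : ∀ I, MeasurableSet (Z I) := by
      intro I
      refine MeasurableSet.inter (measurable_fst hQ.compl) ?_
      have : {p : X × (Fin k → Y) |
          ∀ i, P p.1 (p.2 i) ∧ e (p.2 i) ∈ Set.Ioo ((I i).1 : ℝ) ((I i).2 : ℝ)} =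
          ⋂ i, ({p | P p.1 (p.2 i)} ∩ {p | e (p.2 i) ∈ Set.Ioo ((I i).1 : ℝ) ((I i).2 : ℝ)}) := by
        ext p; simp
      change MeasurableSet {p : X × (Fin k → Y) |
          ∀ i, P p.1 (p.2 i) ∧ e (p.2 i) ∈ Set.Ioo ((I i).1 : ℝ) ((I i).2 : ℝ)}
      rw [this]
      refine MeasurableSet.iInter fun i => MeasurableSet.inter ?_ ?_
      · have hm : Measurable (fun p : X × (Fin k → Y) => (p.1, p.2 i)) := by fun_prop
        exact hm hP
      · have hm : Measurable (fun p : X × (Fin k → Y) => e (p.2 i)) :=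
          he.measurable.comp (by fun_prop)
        exact hm measurableSet_Ioo
    have hdisj : ∀ I : Fin k → ℚ × ℚ, (Pairwise fun i j => Disjoint
        (Set.Ioo ((I i).1 : ℝ) ((I i).2 : ℝ)) (Set.Ioo ((I j).1 : ℝ) ((I j).2 : ℝ))) →
        MeasurableSet (Prod.fst '' Z I) := by
      intro I hI
      refine MeasurableSet.image_of_measurable_injOn (hZ I) measurable_fst ?_
      rintro ⟨x, y⟩ ⟨hx, hy⟩ ⟨x', y'⟩ ⟨-, hy'⟩ (rfl : x = x')
      simp only [Prod.mk.injEq, true_and]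
      by_contra hne
      obtain ⟨i, hi⟩ := Function.ne_iff.1 hne
      have hyinj : ∀ a b, e (y a) = e (y b) → a = b := by
        intro a b hab
        by_contra hne
        exact Set.disjoint_left.1 (hI hne) (hy a).2 (by
            rw [show e (y a) = e (y b) by exact hab]; exact (hy b).2)
      refine hx ⟨Fin.cons (y' i) y, Fin.cons_injective_iff.2 ⟨?_, ?_⟩, ?_⟩
      · rintro ⟨a, ha⟩
        rcases eq_or_ne a i with rfl | hai
        · exact hi ha
        · exact Set.disjoint_left.1 (hI hai) (hy a).2
            (show e (y a) ∈ _ by rw [show y a = y' i from ha]; exact (hy' i).2)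
      · intro a b hab
        exact hyinj a b (congrArg e hab)
      · intro a
        refine Fin.cases ?_ (fun a => ?_) a
        · simpa using (hy' i).1
        · simpa using (hy a).1
    have : {x | ∃ y : Fin k → Y, Function.Injective y ∧ ∀ i, P x (y i)} =
        Q ∪ ⋃ I : {I : Fin k → ℚ × ℚ // (Pairwise fun i j => Disjoint
        (Set.Ioo ((I i).1 : ℝ) ((I i).2 : ℝ)) (Set.Ioo ((I j).1 : ℝ) ((I j).2 : ℝ)))},
          Prod.fst '' Z I.1 := by
      ext x
      constructor
      · rintro ⟨y, hy, hyP⟩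
        by_cases hx : x ∈ Q
        · exact Or.inl hx
        refine Or.inr (Set.mem_iUnion.2 ?_)
        have hey : Function.Injective (e ∘ y) := he.injective.comp hy
        obtain ⟨U, hU, hUd⟩ := (Set.finite_range (e ∘ y)).t2_separation
        have : ∀ i, ∃ I : ℚ × ℚ, e (y i) ∈ Set.Ioo (I.1 : ℝ) (I.2 : ℝ) ∧
            Set.Ioo (I.1 : ℝ) (I.2 : ℝ) ⊆ U (e (y i)) := by
          intro i
          obtain ⟨s, hs, h1, h2⟩ := Real.isTopologicalBasis_Ioo_rat.mem_nhds_iff.1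
            ((hU (e (y i))).2.mem_nhds (hU (e (y i))).1)
          simp only [Set.mem_iUnion, Set.mem_singleton_iff] at hs
          obtain ⟨a, b, -, rfl⟩ := hs
          exact ⟨(a, b), h1, h2⟩
        choose I hI hIU using this
        refine ⟨⟨I, fun i j hij => ?_⟩, ⟨(x, y), ⟨hx, fun i => ⟨hyP i, hI i⟩⟩, rfl⟩⟩
        exact (hUd (Set.mem_range_self i) (Set.mem_range_self j) (hey.ne hij)).mono
          (hIU i) (hIU j)
      · rintro (⟨y, hy, hyP⟩ | hx)
        · exact ⟨y ∘ Fin.castSucc, hy.comp (Fin.castSucc_injective k), fun i => hyP _⟩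
        · obtain ⟨⟨I, hI⟩, ⟨⟨x', y⟩, ⟨-, hy⟩, rfl⟩⟩ := Set.mem_iUnion.1 hx
          refine ⟨y, fun a b hab => ?_, fun i => (hy i).1⟩
          by_contra hne
          exact Set.disjoint_left.1 (hI hne) (hy a).2 (by
            rw [show e (y a) = e (y b) by exact congrArg e hab]; exact (hy b).2)
    rw [this]
    exact hQ.union (MeasurableSet.iUnion fun I => hdisj I.1 I.2)

/-- `Φ` is a sequence of Borel functions enumerating the connected component of every vertex. -/
structure OrbitEnum {X : Type*} [MeasurableSpace X] (G : SimpleGraph X) (Φ : ℕ → X → X) :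
    Prop where
  meas : ∀ k, Measurable (Φ k)
  reach : ∀ x y, G.Reachable x y ↔ ∃ k, Φ k x = y
  finite_fiber : ∀ k x, {y | Φ k y = x}.Finite

lemma not_exists_injective_of_encard_le {X : Type*} {s : Set X} {d : ℕ} (h : s.encard ≤ d) :
    ¬ ∃ y : Fin (d + 1) → X, Function.Injective y ∧ ∀ i, y i ∈ s := by
  rintro ⟨y, hy, hys⟩
  have h1 : (Set.range y).encard ≤ d := (Set.encard_le_encard (Set.range_subset_iff.2 hys)).trans h
  rw [← Set.image_univ, hy.encard_image, Set.encard_univ, ENat.card_eq_coe_fintype_card,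
    Fintype.card_fin] at h1
  exact absurd (by exact_mod_cast h1 : d + 1 ≤ d) (by omega)

/-- A Borel graph of bounded degree is covered by countably many Borel functions. -/
lemma exists_measurable_neighbor_functions {X : Type*} [MeasurableSpace X] [StandardBorelSpace X]
    (G : SimpleGraph X) (hG : MeasurableSet {p : X × X | G.Adj p.1 p.2}) (d : ℕ)
    (hdeg : ∀ x : X, (G.neighborSet x).encard ≤ (d : ℕ∞)) :
    ∃ φ : ℕ → X → X, (∀ k, Measurable (φ k)) ∧ (∀ k x, φ k x = x ∨ G.Adj x (φ k x)) ∧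
      ∀ x y, G.Adj x y → ∃ k, φ k x = y := by
  classical
  obtain ⟨e, he⟩ := exists_measurableEmbedding_real X
  let I : ℚ × ℚ → Set X := fun I => e ⁻¹' Set.Ioo (I.1 : ℝ) (I.2 : ℝ)
  have hI : ∀ i, MeasurableSet (I i) := fun i => he.measurable measurableSet_Ioo
  have key : ∀ (U : Set X), MeasurableSet U → ∀ k, MeasurableSet
      {x | ∃ y : Fin k → X, Function.Injective y ∧ ∀ i, G.Adj x (y i) ∧ y i ∈ U} := by
    intro U hU k
    refine measurableSet_exists_injective (P := fun x y => G.Adj x y ∧ y ∈ U)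
      (hG.inter (measurable_snd hU)) d ?_ k
    rintro x ⟨y, hy, hyP⟩
    exact not_exists_injective_of_encard_le (hdeg x) ⟨y, hy, fun i => (hyP i).1⟩
  have key1 : ∀ (U : Set X), MeasurableSet U → MeasurableSet {x | ∃ y, G.Adj x y ∧ y ∈ U} := by
    intro U hU
    convert key U hU 1 using 1
    ext x
    constructor
    · rintro ⟨y, hy⟩
      exact ⟨fun _ => y, Function.injective_of_subsingleton _, fun _ => hy⟩
    · rintro ⟨y, -, hy⟩
      exact ⟨y 0, hy 0⟩
  let S : ℚ × ℚ → Set X := fun i => {x | ∃! y, G.Adj x y ∧ y ∈ I i}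
  have hS : ∀ i, MeasurableSet (S i) := by
    intro i
    have : S i = {x | ∃ y, G.Adj x y ∧ y ∈ I i} \
        {x | ∃ y : Fin 2 → X, Function.Injective y ∧ ∀ j, G.Adj x (y j) ∧ y j ∈ I i} := by
      ext x
      constructor
      · rintro ⟨y, hy, hu⟩
        refine ⟨⟨y, hy⟩, ?_⟩
        rintro ⟨z, hz, hzP⟩
        have : z 0 = z 1 := (hu _ (hzP 0)).trans (hu _ (hzP 1)).symm
        exact absurd (hz this) (by decide)
      · rintro ⟨⟨y, hy⟩, hn⟩
        refine ⟨y, hy, fun z hz => ?_⟩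
        by_contra hne
        refine hn ⟨![z, y], ?_, ?_⟩
        · intro a b hab
          fin_cases a <;> fin_cases b <;> simp_all [eq_comm]
        · intro j
          fin_cases j
          · exact hz
          · exact hy
    rw [this]
    exact (key1 _ (hI i)).diff (key _ (hI i) 2)
  let f : ℚ × ℚ → X → X := fun i x => if h : x ∈ S i then h.choose else x
  have hfS : ∀ i x, x ∈ S i → G.Adj x (f i x) ∧ f i x ∈ I i := by
    intro i x h
    simp only [f, dif_pos h]
    exact h.choose_spec.1
  have hfm : ∀ i, Measurable (f i) := by
    intro i U hU
    have : f i ⁻¹' U = (S i ∩ {x | ∃ y, G.Adj x y ∧ y ∈ I i ∩ U}) ∪ ((S i)ᶜ ∩ U) := by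
      ext x
      by_cases h : x ∈ S i
      · have h1 := hfS i x h
        constructor
        · intro hx
          exact Or.inl ⟨h, f i x, h1.1, h1.2, hx⟩
        · rintro (⟨-, y, hy, hyI, hyU⟩ | ⟨hn, -⟩)
          · obtain rfl : y = f i x := h.unique ⟨hy, hyI⟩ h1
            exact hyU
          · exact absurd h hn
      · have : f i x = x := by simp only [f, dif_neg h]
        simp [h, this]
    rw [this]
    exact ((hS i).inter (key1 _ ((hI i).inter hU))).union ((hS i).compl.inter hU)
  refine ⟨fun k => (Encodable.decode (α := ℚ × ℚ) k).elim id f, ?_, ?_, ?_⟩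
  · intro k
    dsimp only
    cases Encodable.decode (α := ℚ × ℚ) k with
    | none => exact measurable_id
    | some i => exact hfm i
  · intro k x
    dsimp only
    cases Encodable.decode (α := ℚ × ℚ) k with
    | none => exact Or.inl rfl
    | some i =>
      by_cases h : x ∈ S i
      · exact Or.inr (hfS i x h).1
      · exact Or.inl (by simp only [Option.elim_some, f, dif_neg h])
  · intro x y hxy
    have hfin : ((G.neighborSet x) \ {y}).Finite :=
      (Set.finite_of_encard_le_coe (hdeg x)).sdiff
    have hcl : IsClosed (e '' ((G.neighborSet x) \ {y})) := (hfin.image e).isClosed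
    have hy : e y ∈ (e '' ((G.neighborSet x) \ {y}))ᶜ := by
      rintro ⟨z, hz, hze⟩
      exact hz.2 (he.injective hze)
    obtain ⟨s, hs, h1, h2⟩ := Real.isTopologicalBasis_Ioo_rat.mem_nhds_iff.1
      (hcl.isOpen_compl.mem_nhds hy)
    simp only [Set.mem_iUnion, Set.mem_singleton_iff] at hs
    obtain ⟨a, b, -, rfl⟩ := hs
    have hxS : x ∈ S (a, b) := by
      refine ⟨y, ⟨hxy, h1⟩, fun z hz => ?_⟩
      by_contra hne
      exact h2 hz.2 ⟨z, ⟨hz.1, hne⟩, rfl⟩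
    refine ⟨Encodable.encode (a, b), ?_⟩
    simp only [Encodable.encodek, Option.elim_some]
    exact hxS.unique (hfS _ _ hxS) ⟨hxy, h1⟩

/-- The component of every vertex of a Borel graph of bounded degree is enumerated by Borel
functions. -/
lemma exists_orbitEnum {X : Type*} [MeasurableSpace X] [StandardBorelSpace X]
    (G : SimpleGraph X) (hG : MeasurableSet {p : X × X | G.Adj p.1 p.2}) (d : ℕ)
    (hdeg : ∀ x : X, (G.neighborSet x).encard ≤ (d : ℕ∞)) : ∃ Φ, OrbitEnum G Φ := by
  obtain ⟨φ, hm, hφ, hcov⟩ := exists_measurable_neighbor_functions G hG d hdeg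
  let w : List ℕ → X → X := fun l x => l.foldr (fun k y => φ k y) x
  refine ⟨fun n => w (Denumerable.ofNat (List ℕ) n), ⟨fun n => ?_, fun x y => ⟨?_, ?_⟩, fun n => ?_⟩⟩
  · generalize Denumerable.ofNat (List ℕ) n = l
    induction l with
    | nil => exact measurable_id
    | cons k l ih => exact (hm k).comp ih
  · intro h
    suffices H : ∃ l, w l x = y by
      obtain ⟨l, hl⟩ := H
      exact ⟨Encodable.encode l, by simpa using hl⟩
    obtain ⟨p⟩ := h.symm
    induction p with
    | nil => exact ⟨[], rfl⟩
    | cons hadj p ih =>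
      obtain ⟨l, hl⟩ := ih ⟨p.reverse⟩
      obtain ⟨k, hk⟩ := hcov _ _ hadj.symm
      exact ⟨k :: l, by simp only [w, List.foldr_cons] at hl ⊢; rw [hl, hk]⟩
  · rintro ⟨n, rfl⟩
    generalize Denumerable.ofNat (List ℕ) n = l
    induction l with
    | nil => exact SimpleGraph.Reachable.refl _
    | cons k l ih =>
      refine ih.trans ?_
      change G.Reachable (w l x) (φ k (w l x))
      rcases hφ k (w l x) with h | h
      · rw [h]
      · exact h.reachable
  · generalize Denumerable.ofNat (List ℕ) n = l
    have hfib : ∀ k x, {y | φ k y = x}.Finite := by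
      intro k x
      refine ((Set.finite_of_encard_le_coe (hdeg x)).insert x).subset ?_
      rintro y rfl
      rcases hφ k y with h | h
      · exact Or.inl h.symm
      · exact Or.inr h.symm
    induction l with
    | nil =>
      intro x
      exact Set.finite_singleton x
    | cons k l ih =>
      intro x
      refine ((hfib k x).biUnion fun z _ => ih z).subset ?_
      intro y hy
      exact Set.mem_biUnion (x := w l y) hy rfl

section Measurability

variable {X : Type*} [MeasurableSpace X] {G : SimpleGraph X} {Φ : ℕ → X → X}

/-- Quantification over a connected component preserves Borelness. -/
lemma OrbitEnum.measurableSet_exists {Z : Type*} [MeasurableSpace Z] (h : OrbitEnum G Φ)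
    {g : Z → X} (hg : Measurable g) {P : Z → X → Prop}
    (hP : MeasurableSet {p : Z × X | P p.1 p.2}) (hr : ∀ z y, P z y → G.Reachable (g z) y) :
    MeasurableSet {z | ∃ y, P z y} := by
  have : {z | ∃ y, P z y} = ⋃ k, {z | P z (Φ k (g z))} := by
    ext z
    simp only [Set.mem_iUnion]
    constructor
    · rintro ⟨y, hy⟩
      obtain ⟨k, hk⟩ := (h.reach _ _).1 (hr z y hy)
      exact ⟨k, by change P z (Φ k (g z)); rwa [hk]⟩
    · rintro ⟨k, hk⟩
      exact ⟨_, hk⟩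
  rw [this]
  refine MeasurableSet.iUnion fun k => ?_
  have hm : Measurable fun z => (z, Φ k (g z)) := measurable_id.prodMk ((h.meas k).comp hg)
  exact hm hP

/-- Borel relations contained in the connectedness relation have Borel transitive closure. -/
lemma OrbitEnum.measurableSet_reflTransGen {Z : Type*} [MeasurableSpace Z] [MeasurableEq X]
    (h : OrbitEnum G Φ) {R : Z → X → X → Prop}
    (hR : MeasurableSet {p : Z × X × X | R p.1 p.2.1 p.2.2})
    (hr : ∀ z a b, R z a b → G.Reachable a b) :
    MeasurableSet {p : Z × X × X | Relation.ReflTransGen (R p.1) p.2.1 p.2.2} := by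
  let T : ℕ → Z → X → X → Prop := fun n z =>
    n.rec (fun a b => a = b) (fun _ S a b => ∃ c, S a c ∧ R z c b)
  have hT : ∀ n z a b, T n z a b → G.Reachable a b := by
    intro n z
    induction n with
    | zero => rintro a _ rfl; exact SimpleGraph.Reachable.refl _
    | succ n ih => rintro a b ⟨c, h1, h2⟩; exact (ih a c h1).trans (hr _ _ _ h2)
  have hTm : ∀ n, MeasurableSet {p : Z × X × X | T n p.1 p.2.1 p.2.2} := by
    intro n
    induction n with
    | zero =>
      exact measurableSet_eq_fun (f := fun p : Z × X × X => p.2.1) (g := fun p => p.2.2)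
        (by fun_prop) (by fun_prop)
    | succ n ih =>
      refine h.measurableSet_exists (Z := Z × X × X) (g := fun p => p.2.1)
        (P := fun p c => T n p.1 p.2.1 c ∧ R p.1 c p.2.2) (by fun_prop) ?_ ?_
      · have h1 : Measurable fun q : (Z × X × X) × X => (q.1.1, q.1.2.1, q.2) := by fun_prop
        have h2 : Measurable fun q : (Z × X × X) × X => (q.1.1, q.2, q.1.2.2) := by fun_prop
        exact (h1 ih).inter (h2 hR)
      · rintro p c ⟨h1, -⟩
        exact hT _ _ _ _ h1
  have : {p : Z × X × X | Relation.ReflTransGen (R p.1) p.2.1 p.2.2} =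
      ⋃ n, {p : Z × X × X | T n p.1 p.2.1 p.2.2} := by
    ext ⟨z, a, b⟩
    simp only [Set.mem_iUnion]
    constructor
    · intro hab
      change Relation.ReflTransGen (R z) a b at hab
      induction hab with
      | refl => exact ⟨0, rfl⟩
      | tail _ hbc ih =>
        obtain ⟨n, hn⟩ := ih
        exact ⟨n + 1, _, hn, hbc⟩
    · rintro ⟨n, hn⟩
      change Relation.ReflTransGen (R z) a b
      change T n z a b at hn
      induction n generalizing b with
      | zero => exact (show a = b from hn) ▸ Relation.ReflTransGen.refl
      | succ n ih =>
        obtain ⟨c, h1, h2⟩ := hn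
        exact (ih c h1).tail h2
  rw [this]
  exact MeasurableSet.iUnion hTm

end Measurability

section Greedy

instance countable_lex {α β : Type*} [Countable α] [Countable β] : Countable (α ×ₗ β) :=
  inferInstanceAs (Countable (α × β))

open Classical in
/-- A color outside of `s`, if there is one. -/
noncomputable def avoidingColor {d : ℕ} [NeZero d] (s : Set (Fin d)) : Fin d :=
  if h : ∃ j, j ∉ s then h.choose else 0

lemma avoidingColor_notMem {d : ℕ} [NeZero d] {s : Set (Fin d)} (h : s.encard < d) :
    avoidingColor s ∉ s := by
  have h' : ∃ j, j ∉ s := by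
    by_contra! hn
    rw [Set.eq_univ_of_forall hn, Set.encard_univ, ENat.card_eq_coe_fintype_card,
      Fintype.card_fin] at h
    exact lt_irrefl _ h
  rw [avoidingColor, dif_pos h']
  exact h'.choose_spec

variable {X W : Type*} [LinearOrder W] [WellFoundedLT W]

/-- The greedy coloring along the order given by `π`. -/
noncomputable def greedyColor (C : SimpleGraph X) (π : X → W) (d : ℕ) [NeZero d] : X → Fin d :=
  (InvImage.wf π (wellFounded_lt (α := W))).fix fun x ih =>
    avoidingColor {j | ∃ y, ∃ h : π y < π x, C.Adj x y ∧ ih y h = j}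

lemma greedyColor_eq (C : SimpleGraph X) (π : X → W) (d : ℕ) [NeZero d] (x : X) :
    greedyColor C π d x =
      avoidingColor {j | ∃ y, π y < π x ∧ C.Adj x y ∧ greedyColor C π d y = j} := by
  rw [greedyColor, WellFounded.fix_eq]
  simp only [exists_prop]

lemma greedyColor_ne (C : SimpleGraph X) (π : X → W) (d : ℕ) [NeZero d] {x y : X}
    (hx : {y | C.Adj x y ∧ π y < π x}.encard < d) (hxy : C.Adj x y) (hlt : π y < π x) :
    greedyColor C π d x ≠ greedyColor C π d y := by
  intro h
  rw [greedyColor_eq] at h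
  have := avoidingColor_notMem
    (s := {j | ∃ y, π y < π x ∧ C.Adj x y ∧ greedyColor C π d y = j}) ?_
  · exact this ⟨y, hlt, hxy, h.symm⟩
  · refine lt_of_le_of_lt ?_ hx
    refine le_trans (Set.encard_le_encard ?_) (Set.encard_image_le (greedyColor C π d) _)
    rintro j ⟨z, h1, h2, h3⟩
    exact ⟨z, ⟨h2, h1⟩, h3⟩

lemma greedyColor_measurable [MeasurableSpace X] {G : SimpleGraph X} {Φ : ℕ → X → X}
    (hΦ : OrbitEnum G Φ) [Countable W] (C : SimpleGraph X)
    (hC : MeasurableSet {p : X × X | C.Adj p.1 p.2}) (hCG : ∀ x y, C.Adj x y → G.Reachable x y)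
    (π : X → W) (hπ : ∀ p, MeasurableSet {x | π x = p}) (d : ℕ) [NeZero d] :
    Measurable (greedyColor C π d) := by
  suffices H : ∀ p j, MeasurableSet {x | π x = p ∧ greedyColor C π d x = j} by
    refine measurable_to_countable' fun j => ?_
    have : greedyColor C π d ⁻¹' {j} = ⋃ p, {x | π x = p ∧ greedyColor C π d x = j} := by
      ext x; simp
    rw [this]
    exact MeasurableSet.iUnion fun p => H p j
  intro p
  induction p using WellFoundedLT.induction with
  | ind p ih =>
  intro j
  have h1 : ∀ i, MeasurableSet
      {x | ∃ y, C.Adj x y ∧ π y < p ∧ greedyColor C π d y = i} := by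
    intro i
    refine hΦ.measurableSet_exists (g := fun x => x)
      (P := fun x y => C.Adj x y ∧ π y < p ∧ greedyColor C π d y = i) measurable_id ?_
      (fun x y h => hCG x y h.1)
    have h2 : MeasurableSet {y | π y < p ∧ greedyColor C π d y = i} := by
      have : {y | π y < p ∧ greedyColor C π d y = i} =
          ⋃ q : {q // q < p}, {x | π x = q ∧ greedyColor C π d x = i} := by
        ext x
        simp only [Set.mem_iUnion, Subtype.exists]
        constructor
        · rintro ⟨h, h'⟩
          exact ⟨π x, h, rfl, h'⟩
        · rintro ⟨q, h, h', h''⟩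
          exact ⟨h'.symm ▸ h, h''⟩
      rw [this]
      exact MeasurableSet.iUnion fun q => ih q q.2 i
    exact hC.inter (measurable_snd h2)
  have h2 : {x | π x = p ∧ greedyColor C π d x = j} =
      ⋃ s : {s : Set (Fin d) // avoidingColor s = j}, {x | π x = p} ∩
        ⋂ i, {x | (∃ y, C.Adj x y ∧ π y < p ∧ greedyColor C π d y = i) ↔ i ∈ s.1} := by
    ext x
    simp only [Set.mem_iUnion, Set.mem_inter_iff, Set.mem_iInter]
    constructor
    · rintro ⟨rfl, hx⟩
      rw [greedyColor_eq] at hx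
      refine ⟨⟨_, hx⟩, rfl, fun i => ?_⟩
      exact ⟨fun ⟨y, h1, h2, h3⟩ => ⟨y, h2, h1, h3⟩, fun ⟨y, h1, h2, h3⟩ => ⟨y, h2, h1, h3⟩⟩
    · rintro ⟨⟨s, rfl⟩, hp, hx⟩
      obtain rfl : π x = p := hp
      refine ⟨rfl, ?_⟩
      rw [greedyColor_eq]
      congr 1
      ext i
      rw [← show _ ↔ i ∈ s from hx i]
      exact ⟨fun ⟨y, h1, h2, h3⟩ => ⟨y, h2, h1, h3⟩, fun ⟨y, h1, h2, h3⟩ => ⟨y, h2, h1, h3⟩⟩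
  rw [h2]
  refine MeasurableSet.iUnion fun s => (hπ p).inter (MeasurableSet.iInter fun i => ?_)
  by_cases hi : i ∈ s.1
  · simpa only [hi, iff_true] using h1 i
  · simp only [hi, iff_false]
    exact (h1 i).compl

/-- A locally finite Borel graph has a countable Borel coloring. -/
lemma exists_measurable_nat_coloring [MeasurableSpace X] [StandardBorelSpace X]
    {G : SimpleGraph X} {Φ : ℕ → X → X}
    (hΦ : OrbitEnum G Φ) (C : SimpleGraph X)
    (hC : MeasurableSet {p : X × X | C.Adj p.1 p.2}) (hCG : ∀ x y, C.Adj x y → G.Reachable x y)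
    (hfin : ∀ x, (C.neighborSet x).Finite) :
    ∃ c : X → ℕ, Measurable c ∧ ∀ x y, C.Adj x y → c x ≠ c y := by
  classical
  obtain ⟨e, he⟩ := exists_measurableEmbedding_real X
  let U : ℕ → Set X := fun n => (Encodable.decode (α := ℚ × ℚ) n).elim ∅
    fun I => e ⁻¹' Set.Ioo (I.1 : ℝ) (I.2 : ℝ)
  have hU : ∀ n, MeasurableSet (U n) := by
    intro n
    simp only [U]
    cases Encodable.decode (α := ℚ × ℚ) n with
    | none => exact MeasurableSet.empty
    | some I => exact he.measurable measurableSet_Ioo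
  have hex : ∀ x, ∃ n, x ∈ U n ∧ ¬ ∃ y, C.Adj x y ∧ y ∈ U n := by
    intro x
    have hcl : IsClosed (e '' (C.neighborSet x)) := ((hfin x).image e).isClosed
    have hy : e x ∈ (e '' (C.neighborSet x))ᶜ := by
      rintro ⟨z, hz, hze⟩
      obtain rfl := he.injective hze
      exact C.loopless.irrefl _ hz
    obtain ⟨s, hs, h1, h2⟩ := Real.isTopologicalBasis_Ioo_rat.mem_nhds_iff.1
      (hcl.isOpen_compl.mem_nhds hy)
    simp only [Set.mem_iUnion, Set.mem_singleton_iff] at hs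
    obtain ⟨a, b, -, rfl⟩ := hs
    refine ⟨Encodable.encode (a, b), ?_, ?_⟩
    · simp only [U, Encodable.encodek, Option.elim_some]
      exact h1
    · rintro ⟨y, hy, hyU⟩
      simp only [U, Encodable.encodek, Option.elim_some] at hyU
      exact h2 hyU ⟨y, hy, rfl⟩
  refine ⟨fun x => Nat.find (hex x), measurable_find hex fun n => ?_, fun x y hxy hne => ?_⟩
  · refine (hU n).inter (MeasurableSet.compl ?_)
    exact hΦ.measurableSet_exists (g := fun x => x) (P := fun x y => C.Adj x y ∧ y ∈ U n)
      measurable_id (hC.inter (measurable_snd (hU n))) fun x y h => hCG x y h.1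
  · have hx := Nat.find_spec (hex x)
    have hy := (Nat.find_spec (hex y)).1
    simp only at hne
    rw [← hne] at hy
    exact hx.2 ⟨y, hxy, hy⟩

/-- A Borel graph with degrees below `d` has a Borel `d`-coloring. -/
lemma exists_measurable_coloring_of_degree_lt [MeasurableSpace X] [StandardBorelSpace X]
    {G : SimpleGraph X} {Φ : ℕ → X → X}
    (hΦ : OrbitEnum G Φ) (C : SimpleGraph X)
    (hC : MeasurableSet {p : X × X | C.Adj p.1 p.2}) (hCG : ∀ x y, C.Adj x y → G.Reachable x y)
    (d : ℕ) [NeZero d] (hdeg : ∀ x, (C.neighborSet x).encard < d) :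
    ∃ c : X → Fin d, Measurable c ∧ ∀ x y, C.Adj x y → c x ≠ c y := by
  obtain ⟨c, hc, hcp⟩ := exists_measurable_nat_coloring hΦ C hC hCG
    (fun x => Set.finite_of_encard_le_coe (hdeg x).le)
  refine ⟨greedyColor C c d, greedyColor_measurable hΦ C hC hCG c
    (fun p => hc (measurableSet_singleton p)) d, ?_⟩
  have key : ∀ x, {y | C.Adj x y ∧ c y < c x}.encard < d := fun x =>
    lt_of_le_of_lt (Set.encard_le_encard fun y hy => hy.1) (hdeg x)
  intro x y hxy
  rcases lt_or_gt_of_ne (hcp x y hxy) with h | h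
  · exact (greedyColor_ne C c d (key y) hxy.symm h).symm
  · exact greedyColor_ne C c d (key x) hxy h

lemma encard_earlier_lt {V L : Type*} [LinearOrder L] {G : SimpleGraph V} {π : V → L} {d : ℕ}
    {x z : V}
    (hdeg : (G.neighborSet x).encard ≤ d) (hz : G.Adj x z) (hlt : π x < π z) :
    {y | G.Adj x y ∧ π y < π x}.encard < d := by
  refine lt_of_lt_of_le ?_ hdeg
  have hfin := Set.finite_of_encard_le_coe hdeg
  refine Set.Finite.encard_lt_encard (hfin.subset fun y hy => hy.1) ?_
  exact ⟨fun y hy => hy.1, fun h => absurd (h hz).2 hlt.not_gt⟩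

/-- Any rank function yields a coloring which is proper on the vertices having a neighbor of
larger rank. -/
lemma exists_coloring_of_rank {G : SimpleGraph X} {d : ℕ} (hd : 0 < d)
    (hdeg : ∀ x : X, (G.neighborSet x).encard ≤ (d : ℕ∞)) (ρ : X → W) :
    ∃ c : X → Fin d, ∀ x y, G.Adj x y → (∃ z, G.Adj x z ∧ ρ x < ρ z) →
      (∃ z, G.Adj y z ∧ ρ y < ρ z) → c x ≠ c y := by
  have : NeZero d := ⟨hd.ne'⟩
  let π : X → W ×ₗ Cardinal := fun x => toLex (ρ x, embeddingToCardinal x)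
  refine ⟨greedyColor G π d, fun x y hxy ⟨z, hz, hρ⟩ ⟨w, hw, hρ'⟩ => ?_⟩
  have hne : π x ≠ π y := by
    intro h
    exact hxy.ne (embeddingToCardinal.injective (congrArg (fun p => (ofLex p).2) h))
  rcases lt_or_gt_of_ne hne with h | h
  · exact (greedyColor_ne G π d (encard_earlier_lt (hdeg y) hw
      (Prod.Lex.toLex_lt_toLex.2 (Or.inl hρ'))) hxy.symm h).symm
  · exact greedyColor_ne G π d (encard_earlier_lt (hdeg x) hz
      (Prod.Lex.toLex_lt_toLex.2 (Or.inl hρ))) hxy h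

/-- A Borel rank function yields a Borel coloring which is proper on the vertices having a
neighbor of larger rank. -/
lemma exists_measurable_coloring_of_rank [MeasurableSpace X] [StandardBorelSpace X]
    {G : SimpleGraph X} {Φ : ℕ → X → X} (hΦ : OrbitEnum G Φ)
    (hG : MeasurableSet {p : X × X | G.Adj p.1 p.2}) {d : ℕ} (hd : 0 < d)
    (hdeg : ∀ x : X, (G.neighborSet x).encard ≤ (d : ℕ∞)) [Countable W] (ρ : X → W)
    (hρ : ∀ p, MeasurableSet {x | ρ x = p}) :
    ∃ c : X → Fin d, Measurable c ∧ ∀ x y, G.Adj x y → (∃ z, G.Adj x z ∧ ρ x < ρ z) →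
      (∃ z, G.Adj y z ∧ ρ y < ρ z) → c x ≠ c y := by
  have : NeZero d := ⟨hd.ne'⟩
  obtain ⟨c, hc, hcp⟩ := exists_measurable_nat_coloring hΦ G hG (fun _ _ h => h.reachable)
    (fun x => Set.finite_of_encard_le_coe (hdeg x))
  let π : X → W ×ₗ ℕ := fun x => toLex (ρ x, c x)
  refine ⟨greedyColor G π d, greedyColor_measurable hΦ G hG (fun _ _ h => h.reachable) π ?_ d,
    fun x y hxy ⟨z, hz, hρ⟩ ⟨w, hw, hρ'⟩ => ?_⟩
  · intro p
    have : {x | π x = p} = {x | ρ x = (ofLex p).1} ∩ c ⁻¹' {(ofLex p).2} := by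
      ext x
      constructor
      · rintro rfl
        exact ⟨rfl, rfl⟩
      · rintro ⟨h1, h2⟩
        exact congrArg toLex (Prod.ext h1 h2)
    rw [this]
    exact (hρ _).inter (hc (measurableSet_singleton _))
  have hne : π x ≠ π y := by
    intro h
    exact hcp x y hxy (congrArg (fun p => (ofLex p).2) h)
  rcases lt_or_gt_of_ne hne with h | h
  · exact (greedyColor_ne G π d (encard_earlier_lt (hdeg y) hw
      (Prod.Lex.toLex_lt_toLex.2 (Or.inl hρ'))) hxy.symm h).symm
  · exact greedyColor_ne G π d (encard_earlier_lt (hdeg x) hz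
      (Prod.Lex.toLex_lt_toLex.2 (Or.inl hρ))) hxy h

end Greedy

section Rank

variable {X : Type*} [MeasurableSpace X] {G : SimpleGraph X} {Φ : ℕ → X → X}

lemma measurableSet_toLex_eq {f g : X → ℕ} (hf : Measurable f) (hg : Measurable g) (p : ℕ ×ₗ ℕ) :
    MeasurableSet {x | toLex (f x, g x) = p} := by
  have : {x | toLex (f x, g x) = p} = f ⁻¹' {(ofLex p).1} ∩ g ⁻¹' {(ofLex p).2} := by
    ext x
    constructor
    · rintro rfl
      exact ⟨rfl, rfl⟩
    · rintro ⟨h1, h2⟩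
      exact congrArg toLex (Prod.ext h1 h2)
  rw [this]
  exact (hf (measurableSet_singleton _)).inter (hg (measurableSet_singleton _))

open Classical in
/-- Every vertex which is connected to the Borel set `A` but does not belong to it has a neighbor
of larger rank, for a suitable Borel rank function. -/
lemma exists_measurable_rank (hΦ : OrbitEnum G Φ) (C : SimpleGraph X)
    (hC : MeasurableSet {p : X × X | C.Adj p.1 p.2}) (hCG : ∀ x y, C.Adj x y → G.Reachable x y)
    (hfin : ∀ x, (C.neighborSet x).Finite) {A : Set X} (hA : MeasurableSet A) :
    ∃ ρ : X → ℕ ×ₗ ℕ, (∀ p, MeasurableSet {x | ρ x = p}) ∧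
      ∀ x, x ∉ A → (∃ a ∈ A, C.Reachable x a) → ∃ y, C.Adj x y ∧ ρ x < ρ y := by
  obtain ⟨E, hE0, hEs⟩ : ∃ E : ℕ → Set X, E 0 = A ∧
      ∀ n, E (n + 1) = E n ∪ {x | ∃ y, C.Adj x y ∧ y ∈ E n} :=
    ⟨fun n => n.rec A fun _ S => S ∪ {x | ∃ y, C.Adj x y ∧ y ∈ S}, rfl, fun _ => rfl⟩
  have hE : ∀ n, MeasurableSet (E n) := by
    intro n
    induction n with
    | zero => exact hE0 ▸ hA
    | succ n ih =>
      rw [hEs]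
      exact ih.union (hΦ.measurableSet_exists (g := fun x => x)
        (P := fun x y => C.Adj x y ∧ y ∈ E n) measurable_id (hC.inter (measurable_snd ih))
        fun x y h => hCG x y h.1)
  have hEx : ∀ x, ∃ n, x ∈ E n ∨ ∀ m, x ∉ E m := by
    intro x
    rcases Classical.em (∃ n, x ∈ E n) with h | h
    · exact ⟨h.choose, Or.inl h.choose_spec⟩
    · exact ⟨0, Or.inr (not_exists.1 h)⟩
  let δ : X → ℕ := fun x => Nat.find (hEx x)
  have hδ : Measurable δ := measurable_find hEx fun n =>
    (hE n).union (by
      have : {x | ∀ m, x ∉ E m} = ⋂ m, (E m)ᶜ := by ext x; simp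
      change MeasurableSet {x | ∀ m, x ∉ E m}
      rw [this]
      exact MeasurableSet.iInter fun m => (hE m).compl)
  obtain ⟨H, hH0, hHs⟩ : ∃ H : ℕ → Set X, H 0 = Set.univ ∧
      ∀ k, H (k + 1) = {x | ∃ y, C.Adj x y ∧ δ y = δ x + 1 ∧ y ∈ H k} :=
    ⟨fun k => k.rec Set.univ fun _ S => {x | ∃ y, C.Adj x y ∧ δ y = δ x + 1 ∧ y ∈ S}, rfl,
      fun _ => rfl⟩
  have hH : ∀ k, MeasurableSet (H k) := by
    intro k
    induction k with
    | zero => exact hH0 ▸ MeasurableSet.univ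
    | succ k ih =>
      rw [hHs]
      refine hΦ.measurableSet_exists (g := fun x => x)
        (P := fun x y => C.Adj x y ∧ δ y = δ x + 1 ∧ y ∈ H k) measurable_id
        (hC.inter (MeasurableSet.inter ?_ (measurable_snd ih))) fun x y h => hCG x y h.1
      exact measurableSet_eq_fun (hδ.comp measurable_snd)
        ((hδ.comp measurable_fst).add measurable_const)
  have hHanti : ∀ k, H (k + 1) ⊆ H k := by
    intro k
    induction k with
    | zero => exact hH0 ▸ Set.subset_univ _
    | succ k ih =>
      rw [hHs]
      nth_rw 2 [hHs]
      rintro x ⟨y, h1, h2, h3⟩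
      exact ⟨y, h1, h2, ih h3⟩
  have hHmono : Antitone H := antitone_nat_of_succ_le hHanti
  have hHx : ∀ x, ∃ k, x ∉ H (k + 1) ∨ ∀ m, x ∈ H m := by
    intro x
    rcases Classical.em (∀ m, x ∈ H m) with h | h
    · exact ⟨0, Or.inr h⟩
    · push Not at h
      obtain ⟨m, hm⟩ := h
      exact ⟨m, Or.inl fun h => hm (hHanti m h)⟩
  let κ : X → ℕ := fun x => Nat.find (hHx x)
  have hinf : MeasurableSet {x | ∀ m, x ∈ H m} := by
    have : {x | ∀ m, x ∈ H m} = ⋂ m, H m := by ext x; simp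
    rw [this]
    exact MeasurableSet.iInter hH
  have hκ : Measurable κ := measurable_find hHx fun k => (hH (k + 1)).compl.union hinf
  let f : X → ℕ := fun x => if ∀ m, x ∈ H m then 1 else 0
  let g : X → ℕ := fun x => if ∀ m, x ∈ H m then δ x else κ x
  refine ⟨fun x => toLex (f x, g x), measurableSet_toLex_eq
    (Measurable.ite hinf measurable_const measurable_const) (Measurable.ite hinf hδ hκ), ?_⟩
  rintro x hxA ⟨a, haA, hxa⟩
  rcases Classical.em (∀ m, x ∈ H m) with hx | hx
  · have : ∃ y, C.Adj x y ∧ δ y = δ x + 1 ∧ ∀ m, y ∈ H m := by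
      by_contra! hcon
      have hcon' : ∀ y, ∃ m, C.Adj x y → δ y = δ x + 1 → y ∉ H m := by
        intro y
        rcases Classical.em (C.Adj x y ∧ δ y = δ x + 1) with h | h
        · obtain ⟨m, hm⟩ := hcon y h.1 h.2
          exact ⟨m, fun _ _ => hm⟩
        · exact ⟨0, fun h1 h2 => absurd ⟨h1, h2⟩ h⟩
      choose m hm using hcon'
      obtain ⟨M, hM⟩ := ((hfin x).image m).bddAbove
      obtain ⟨y, h1, h2, h3⟩ : ∃ y, C.Adj x y ∧ δ y = δ x + 1 ∧ y ∈ H M := by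
        have := hx (M + 1)
        rwa [hHs] at this
      exact hm y h1 h2 (hHmono (hM ⟨y, h1, rfl⟩) h3)
    obtain ⟨y, h1, h2, h3⟩ := this
    refine ⟨y, h1, Prod.Lex.toLex_lt_toLex.2 (Or.inr ⟨?_, ?_⟩)⟩
    · simp only [f, if_pos hx, if_pos h3]
    · simp only [g, if_pos hx, if_pos h3]
      omega
  · have hreach : ∃ n, x ∈ E n := by
      obtain ⟨p⟩ := hxa
      clear hxA hx
      induction p with
      | nil => exact ⟨0, hE0.symm ▸ haA⟩
      | cons hadj p ih =>
        obtain ⟨n, hn⟩ := ih haA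
        exact ⟨n + 1, (hEs n).symm ▸ Or.inr ⟨_, hadj, hn⟩⟩
    have hxδ : x ∈ E (δ x) := by
      rcases Nat.find_spec (hEx x) with h | h
      · exact h
      · exact absurd hreach (not_exists.2 h)
    have hδle : ∀ y n, y ∈ E n → δ y ≤ n := fun y n h => Nat.find_min' (hEx y) (Or.inl h)
    obtain ⟨n, hn⟩ : ∃ n, δ x = n + 1 := by
      refine Nat.exists_eq_succ_of_ne_zero fun h0 => hxA ?_
      rw [h0, hE0] at hxδ
      exact hxδ
    rw [hn, hEs] at hxδ
    have hnn : x ∉ E n := fun h => by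
      have := hδle x n h
      omega
    obtain ⟨y, hxy, hy⟩ := hxδ.resolve_left hnn
    have hyδ : δ x = δ y + 1 := by
      have h1 := hδle y n hy
      have h2 : y ∈ E (δ y) := by
        rcases Nat.find_spec (hEx y) with h | h
        · exact h
        · exact absurd hy (h n)
      have h3 := hδle x (δ y + 1) ((hEs _).symm ▸ Or.inr ⟨y, hxy, h2⟩)
      omega
    refine ⟨y, hxy, Prod.Lex.toLex_lt_toLex.2 ?_⟩
    rcases Classical.em (∀ m, y ∈ H m) with hy | hy
    · left
      simp only [f, if_neg hx, if_pos hy]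
      exact Nat.zero_lt_one
    · right
      simp only [f, g, if_neg hx, if_neg hy, true_and]
      have h1 : y ∉ H (κ y + 1) := (Nat.find_spec (hHx y)).resolve_right hy
      by_contra hle
      have h2 : x ∈ H (κ y) := by
        rcases Nat.eq_zero_or_pos (κ y) with h0 | h0
        · rw [h0, hH0]; trivial
        · have := Nat.find_min (hHx x) (m := κ y - 1) (by
            have : κ y ≤ κ x := not_lt.1 hle
            change κ y - 1 < κ x
            omega)
          rw [not_or, not_not, Nat.sub_add_cancel h0] at this
          exact this.1
      exact h1 ((hHs _).symm ▸ ⟨x, hxy.symm, hyδ, h2⟩)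

end Rank

section Choice

variable {X : Type*} [MeasurableSpace X]

/-- Borel choice of an element of a countable set. -/
lemma exists_measurable_choice {ι : Type*} [Countable ι] [Nonempty ι] (P : X → ι → Prop)
    (hP : ∀ i, MeasurableSet {x | P x i}) :
    ∃ f : X → ι, (∀ i, MeasurableSet {x | f x = i}) ∧ (∀ x, (∃ i, P x i) → P x (f x)) ∧
      ∀ x y, (∀ i, P x i ↔ P y i) → f x = f y := by
  classical
  obtain ⟨s, hs⟩ := exists_surjective_nat ι
  have hex : ∀ x, ∃ n, P x (s n) ∨ ∀ i, ¬ P x i := by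
    intro x
    rcases Classical.em (∃ i, P x i) with ⟨i, hi⟩ | h
    · obtain ⟨n, rfl⟩ := hs i
      exact ⟨n, Or.inl hi⟩
    · exact ⟨0, Or.inr (not_exists.1 h)⟩
  have hm : Measurable fun x => Nat.find (hex x) := by
    refine measurable_find hex fun n => (hP _).union ?_
    have : {x | ∀ i, ¬ P x i} = ⋂ i, {x | P x i}ᶜ := by
      ext x
      rw [Set.mem_iInter]
      exact Iff.rfl
    change MeasurableSet {x | ∀ i, ¬ P x i}
    rw [this]
    exact MeasurableSet.iInter fun i => (hP i).compl
  refine ⟨fun x => s (Nat.find (hex x)), fun i => ?_, ?_, ?_⟩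
  · exact hm (MeasurableSet.of_discrete (s := {n | s n = i}))
  · rintro x ⟨i, hi⟩
    exact (Nat.find_spec (hex x)).resolve_right fun h => h i hi
  · intro x y hxy
    have : P x = P y := funext fun i => propext (hxy i)
    simp only [this]

lemma le_encard_iff_exists_injective {Y : Type*} {s : Set Y} {k : ℕ} :
    (k : ℕ∞) ≤ s.encard ↔ ∃ y : Fin k → Y, Function.Injective y ∧ ∀ i, y i ∈ s := by
  constructor
  · intro h
    obtain ⟨t, hts, ht⟩ := Set.exists_subset_encard_eq h
    have hfin : t.Finite := Set.finite_of_encard_eq_coe ht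
    have : Nat.card t = k := by
      rw [Nat.card_coe_set_eq, Set.ncard, ht, ENat.toNat_natCast]
    have := hfin.to_subtype
    let e : Fin k ≃ t := (Finite.equivFinOfCardEq ‹Nat.card t = k›).symm
    exact ⟨fun i => e i, Subtype.val_injective.comp e.injective, fun i => hts (e i).2⟩
  · rintro ⟨y, hy, hys⟩
    have h1 := Set.encard_le_encard (Set.range_subset_iff.2 hys)
    rwa [← Set.image_univ, hy.encard_image, Set.encard_univ, ENat.card_eq_coe_fintype_card,
      Fintype.card_fin] at h1

end Choice

section Gadget

/-- Any partial `d`-coloring outside of `S` extends to `S`, as seen from the number of neighbors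
outside of `S`. -/
def Extendable {X : Type*} (G : SimpleGraph X) (d : ℕ) (S : Set X) : Prop :=
  ∀ L : X → Set (Fin d), (∀ v ∈ S, (d : ℕ∞) ≤ (L v).encard + (G.neighborSet v \ S).encard) →
    ∃ c : X → Fin d, ∀ v ∈ S, c v ∈ L v ∧ ∀ u ∈ S, G.Adj u v → c u ≠ c v

variable {X : Type*} [MeasurableSpace X] [StandardBorelSpace X] {G : SimpleGraph X}
  {Φ : ℕ → X → X} {d : ℕ}

lemma measurableSet_extendable [NeZero d] (hG : MeasurableSet {p : X × X | G.Adj p.1 p.2})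
    (hdeg : ∀ x : X, (G.neighborSet x).encard ≤ (d : ℕ∞)) {ι : Type*} [Finite ι]
    {Θ : ι → X → X} (hΘ : ∀ i, Measurable (Θ i)) :
    MeasurableSet {x | Extendable G d (Set.range fun i => Θ i x)} := by
  have hnum : ∀ i (k : ℕ), MeasurableSet
      {x | (k : ℕ∞) ≤ (G.neighborSet (Θ i x) \ Set.range fun i => Θ i x).encard} := by
    intro i k
    have := measurableSet_exists_injective
      (P := fun x y => G.Adj (Θ i x) y ∧ ∀ j, Θ j x ≠ y) (d := d) ?_ ?_ k
    · convert this using 1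
      ext x
      refine le_encard_iff_exists_injective.trans ?_
      refine exists_congr fun y => and_congr_right fun _ => forall_congr' fun j => ?_
      refine and_congr_right fun _ => ?_
      simp
    · refine MeasurableSet.inter ?_ ?_
      · have : Measurable fun p : X × X => (Θ i p.1, p.2) :=
          ((hΘ i).comp measurable_fst).prodMk measurable_snd
        exact this hG
      · have : {p : X × X | ∀ j, Θ j p.1 ≠ p.2} = ⋂ j, {p : X × X | Θ j p.1 = p.2}ᶜ := by
          ext p
          rw [Set.mem_iInter]
          exact Iff.rfl
        change MeasurableSet {p : X × X | ∀ j, Θ j p.1 ≠ p.2}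
        rw [this]
        exact MeasurableSet.iInter fun j => (measurableSet_eq_fun
          ((hΘ j).comp measurable_fst) measurable_snd).compl
    · rintro x ⟨y, hy, hyP⟩
      exact not_exists_injective_of_encard_le (hdeg (Θ i x)) ⟨y, hy, fun j => (hyP j).1⟩
  have hle : ∀ i (a : ℕ∞), MeasurableSet
      {x | (d : ℕ∞) ≤ a + (G.neighborSet (Θ i x) \ Set.range fun i => Θ i x).encard} := by
    intro i a
    induction a using ENat.recTopCoe with
    | top => simp
    | coe a =>
      convert hnum i (d - a) using 3 with x
      rw [ENat.natCast_sub, tsub_le_iff_left]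
  have key : {x | Extendable G d (Set.range fun i => Θ i x)} =
      ⋂ L : ι → Set (Fin d), ((⋂ i, ⋂ j, ({x | Θ i x = Θ j x}ᶜ ∪ {_x | L i = L j})) ∩
        ⋂ i, {x | (d : ℕ∞) ≤ (L i).encard +
          (G.neighborSet (Θ i x) \ Set.range fun i => Θ i x).encard})ᶜ ∪
        ⋃ ψ : ι → Fin d, (⋂ i, ⋂ j, ({x | Θ i x = Θ j x}ᶜ ∪ {_x | ψ i = ψ j})) ∩
          (⋂ i, {_x | ψ i ∈ L i}) ∩ ⋂ i, ⋂ j, ({x | G.Adj (Θ i x) (Θ j x)}ᶜ ∪ {_x | ψ i ≠ ψ j}) := by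
    ext x
    simp only [Set.mem_iInter, Set.mem_union, Set.mem_iUnion, Set.mem_inter_iff,
      Set.mem_compl_iff]
    constructor
    · intro hx L
      by_cases hL : (∀ i j, ¬ Θ i x = Θ j x ∨ L i = L j) ∧ ∀ i, (d : ℕ∞) ≤ (L i).encard +
          (G.neighborSet (Θ i x) \ Set.range fun i => Θ i x).encard
      · right
        have hL1 : ∀ i, (⋃ j, ⋃ _ : Θ j x = Θ i x, L j) = L i := by
          intro i
          ext c
          simp only [Set.mem_iUnion]
          constructor
          · rintro ⟨j, hj, hc⟩
            rwa [← (hL.1 j i).resolve_left (not_not.2 hj)]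
          · exact fun hc => ⟨i, rfl, hc⟩
        obtain ⟨c, hc⟩ := hx (fun v => ⋃ j, ⋃ _ : Θ j x = v, L j) (by
          rintro _ ⟨i, rfl⟩
          simp only [hL1]
          exact hL.2 i)
        refine ⟨fun i => c (Θ i x), ⟨fun i j => ?_, fun i => ?_⟩, fun i j => ?_⟩
        · by_cases h : Θ i x = Θ j x
          · exact Or.inr (congrArg c h)
          · exact Or.inl h
        · have := (hc _ ⟨i, rfl⟩).1
          simp only [hL1] at this
          exact this
        · by_cases h : G.Adj (Θ i x) (Θ j x)
          · exact Or.inr ((hc _ ⟨j, rfl⟩).2 _ ⟨i, rfl⟩ h)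
          · exact Or.inl h
      · exact Or.inl hL
    · intro hx L hL
      rcases hx (fun i => L (Θ i x)) with h | ⟨ψ, ⟨h1, h2⟩, h3⟩
      · refine absurd ⟨fun i j => ?_, fun i => hL _ ⟨i, rfl⟩⟩ h
        by_cases h : Θ i x = Θ j x
        · exact Or.inr (congrArg L h)
        · exact Or.inl h
      · have c0 : Fin d := 0
        classical
        have hψ : ∀ i, (if h : ∃ j, Θ j x = Θ i x then ψ h.choose else c0) = ψ i := by
          intro i
          have h : ∃ j, Θ j x = Θ i x := ⟨i, rfl⟩
          rw [dif_pos h]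
          exact (h1 _ _).resolve_left (not_not.2 h.choose_spec)
        refine ⟨fun v => if h : ∃ j, Θ j x = v then ψ h.choose else c0, ?_⟩
        rintro _ ⟨i, rfl⟩
        simp only [hψ]
        refine ⟨h2 i, ?_⟩
        rintro _ ⟨j, rfl⟩ hadj
        simp only [hψ]
        exact (h3 j i).resolve_left (not_not.2 hadj)
  rw [key]
  refine MeasurableSet.iInter fun L => MeasurableSet.union (MeasurableSet.compl
    (MeasurableSet.inter ?_ (MeasurableSet.iInter fun i => hle i _)))
    (MeasurableSet.iUnion fun ψ => MeasurableSet.inter (MeasurableSet.inter ?_ ?_) ?_)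
  · exact MeasurableSet.iInter fun i => MeasurableSet.iInter fun j =>
      (measurableSet_eq_fun (hΘ i) (hΘ j)).compl.union (MeasurableSet.const _)
  · exact MeasurableSet.iInter fun i => MeasurableSet.iInter fun j =>
      (measurableSet_eq_fun (hΘ i) (hΘ j)).compl.union (MeasurableSet.const _)
  · exact MeasurableSet.iInter fun i => MeasurableSet.const _
  · exact MeasurableSet.iInter fun i => MeasurableSet.iInter fun j =>
      (((hΘ i).prodMk (hΘ j)) hG).compl.union (MeasurableSet.const _)

end Gadget

section Gadget

variable {X : Type*} [MeasurableSpace X] [StandardBorelSpace X] {G : SimpleGraph X}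
  {Φ : ℕ → X → X} {d : ℕ}

lemma encard_univ_le_add {s t : Set (Fin d)} (h : ∀ j, j ∉ s → j ∈ t) :
    (d : ℕ∞) ≤ s.encard + t.encard := by
  calc (d : ℕ∞) = (Set.univ : Set (Fin d)).encard := by
        rw [Set.encard_univ, ENat.card_eq_coe_fintype_card, Fintype.card_fin]
    _ ≤ (s ∪ t).encard := Set.encard_le_encard fun j _ => by
        by_cases hj : j ∈ s
        · exact Or.inl hj
        · exact Or.inr (h j hj)
    _ ≤ _ := Set.encard_union_le s t

lemma exists_measurable_coloring_of_separated_extendable (hΦ : OrbitEnum G Φ) [NeZero d]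
    (hG : MeasurableSet {p : X × X | G.Adj p.1 p.2})
    (hdeg : ∀ x : X, (G.neighborSet x).encard ≤ (d : ℕ∞)) {ι : Type*} [Finite ι] [Nonempty ι]
    {Θ : ι → X → X} (hΘ : ∀ i, Measurable (Θ i)) (hΘG : ∀ i x, G.Reachable x (Θ i x))
    {D : Set X} (hD : MeasurableSet D)
    (hDext : ∀ x ∈ D, Extendable G d (Set.range fun i => Θ i x))
    (hsep : ∀ x ∈ D, ∀ y ∈ D, x ≠ y → ∀ i j, Θ i x ≠ Θ j y ∧ ¬ G.Adj (Θ i x) (Θ j y)) :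
    ∃ c : X → Fin d, Measurable c ∧ ∀ x y, G.Adj x y → (∃ z ∈ D, G.Reachable x z) → c x ≠ c y := by
  classical
  have hGr : ∀ x y, G.Adj x y → G.Reachable x y := fun _ _ h => h.reachable
  set A : Set X := {a | ∃ x, x ∈ D ∧ ∃ i, Θ i x = a} with hA_def
  have hA : MeasurableSet A := by
    refine hΦ.measurableSet_exists (g := fun a => a) (P := fun a x => x ∈ D ∧ ∃ i, Θ i x = a)
      measurable_id ?_ ?_
    · refine (measurable_snd hD).inter ?_
      have : {p : X × X | ∃ i, Θ i p.2 = p.1} = ⋃ i, {p : X × X | Θ i p.2 = p.1} := by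
        ext p
        rw [Set.mem_iUnion]
        exact Iff.rfl
      change MeasurableSet {p : X × X | ∃ i, Θ i p.2 = p.1}
      rw [this]
      exact MeasurableSet.iUnion fun i =>
        measurableSet_eq_fun ((hΘ i).comp measurable_snd) measurable_fst
    · rintro a x ⟨-, i, rfl⟩
      exact (hΘG i x).symm
  obtain ⟨ρ, hρm, hρ⟩ := exists_measurable_rank hΦ G hG hGr
    (fun x => Set.finite_of_encard_le_coe (hdeg x)) hA
  have hc1 := exists_measurable_coloring_of_rank (W := ℕ ×ₗ (ℕ ×ₗ ℕ)) hΦ hG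
    (Nat.pos_of_ne_zero (NeZero.ne d)) hdeg
    (fun x => toLex (if x ∈ A then 1 else 0, ρ x)) ?_
  swap
  · intro p
    have : {x | toLex (if x ∈ A then 1 else 0, ρ x) = p} =
        {x | (if x ∈ A then 1 else 0) = (ofLex p).1} ∩ {x | ρ x = (ofLex p).2} := by
      ext x
      constructor
      · rintro rfl
        exact ⟨rfl, rfl⟩
      · rintro ⟨h1, h2⟩
        exact congrArg toLex (Prod.ext h1 h2)
    rw [this]
    exact ((Measurable.ite hA measurable_const measurable_const)
      (measurableSet_singleton (ofLex p).1)).inter (hρm _)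
  obtain ⟨c1, hc1m, hc1⟩ := hc1
  have hup : ∀ x, x ∉ A → (∃ z ∈ D, G.Reachable x z) → ∃ y, G.Adj x y ∧
      toLex ((if x ∈ A then 1 else 0 : ℕ), ρ x) < toLex ((if y ∈ A then 1 else 0 : ℕ), ρ y) := by
    rintro x hx ⟨z, hz, hxz⟩
    have i0 : ι := Classical.arbitrary ι
    obtain ⟨y, hxy, hlt⟩ := hρ x hx ⟨Θ i0 z, ⟨z, hz, i0, rfl⟩, hxz.trans (hΘG i0 z)⟩
    refine ⟨y, hxy, Prod.Lex.toLex_lt_toLex.2 ?_⟩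
    rw [if_neg hx]
    by_cases hy : y ∈ A
    · left
      rw [if_pos hy]
      exact Nat.zero_lt_one
    · right
      rw [if_neg hy]
      exact ⟨rfl, hlt⟩
  let B : Fin d → Set X := fun j => {a | ∃ y, G.Adj a y ∧ y ∉ A ∧ c1 y = j}
  have hB : ∀ j, MeasurableSet (B j) := fun j =>
    hΦ.measurableSet_exists (g := fun a => a) (P := fun a y => G.Adj a y ∧ y ∉ A ∧ c1 y = j)
      measurable_id (hG.inter (measurable_snd (hA.compl.inter (hc1m (measurableSet_singleton j)))))
      fun a y h => hGr _ _ h.1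
  obtain ⟨f, hfm, hf, -⟩ := exists_measurable_choice (ι := ι → Fin d)
    (fun x ψ => (∀ i, Θ i x ∉ B (ψ i)) ∧ (∀ i j, G.Adj (Θ i x) (Θ j x) → ψ i ≠ ψ j) ∧
      ∀ i j, Θ i x = Θ j x → ψ i = ψ j) (by
    intro ψ
    have : {x | (∀ i, Θ i x ∉ B (ψ i)) ∧ (∀ i j, G.Adj (Θ i x) (Θ j x) → ψ i ≠ ψ j) ∧
        ∀ i j, Θ i x = Θ j x → ψ i = ψ j} = (⋂ i, Θ i ⁻¹' (B (ψ i))ᶜ) ∩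
        ((⋂ i, ⋂ j, ({x | G.Adj (Θ i x) (Θ j x)}ᶜ ∪ {_x | ψ i ≠ ψ j})) ∩
        ⋂ i, ⋂ j, ({x | Θ i x = Θ j x}ᶜ ∪ {_x | ψ i = ψ j})) := by
      ext x
      simp only [Set.mem_iInter, Set.mem_union, Set.mem_inter_iff,
        Set.mem_compl_iff, Set.mem_preimage]
      refine and_congr Iff.rfl (and_congr ?_ ?_) <;>
      · refine forall_congr' fun i => forall_congr' fun j => ?_
        exact imp_iff_not_or
    rw [this]
    refine MeasurableSet.inter (MeasurableSet.iInter fun i => hΘ i (hB _).compl)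
      (MeasurableSet.inter ?_ ?_)
    · exact MeasurableSet.iInter fun i => MeasurableSet.iInter fun j =>
        (((hΘ i).prodMk (hΘ j)) hG).compl.union (MeasurableSet.const _)
    · exact MeasurableSet.iInter fun i => MeasurableSet.iInter fun j =>
        (measurableSet_eq_fun (hΘ i) (hΘ j)).compl.union (MeasurableSet.const _))
  have hfD : ∀ x ∈ D, (∀ i, Θ i x ∉ B (f x i)) ∧
      (∀ i j, G.Adj (Θ i x) (Θ j x) → f x i ≠ f x j) ∧ ∀ i j, Θ i x = Θ j x → f x i = f x j := by
    intro x hx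
    apply hf x
    obtain ⟨c, hc⟩ := hDext x hx (fun a => {j | a ∉ B j}) (by
      rintro _ ⟨i, rfl⟩
      refine (encard_univ_le_add (s := {j | Θ i x ∉ B j}) (t := {j | Θ i x ∈ B j})
        fun j hj => not_not.1 hj).trans ?_
      gcongr
      refine (Set.encard_le_encard ?_).trans (Set.encard_image_le c1 _)
      rintro j ⟨y, hy, hyA, hj⟩
      refine ⟨y, ⟨hy, ?_⟩, hj⟩
      rintro ⟨k, hk⟩
      exact hyA ⟨x, hx, k, hk⟩)
    refine ⟨fun i => c (Θ i x), fun i => (hc _ ⟨i, rfl⟩).1, fun i j h => ?_, fun i j h => ?_⟩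
    · exact (hc _ ⟨j, rfl⟩).2 _ ⟨i, rfl⟩ h
    · exact congrArg c h
  obtain ⟨h, hhm, hh, -⟩ := exists_measurable_choice (ι := ℕ × ι)
    (fun a p => Φ p.1 a ∈ D ∧ Θ p.2 (Φ p.1 a) = a) (fun p =>
      (hΦ.meas p.1 hD).inter (measurableSet_eq_fun ((hΘ p.2).comp (hΦ.meas p.1)) measurable_id))
  let c2 : X → Fin d := fun a => f (Φ (h a).1 a) (h a).2
  have hc2m : Measurable c2 := by
    refine measurable_to_countable' fun j => ?_
    have : c2 ⁻¹' {j} = ⋃ p : ℕ × ι, {a | h a = p} ∩ ⋃ ψ : {ψ : ι → Fin d // ψ p.2 = j},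
        Φ p.1 ⁻¹' {x | f x = ψ.1} := by
      ext a
      simp only [Set.mem_iUnion, Set.mem_inter_iff]
      constructor
      · intro ha
        exact ⟨h a, rfl, ⟨_, ha⟩, rfl⟩
      · rintro ⟨p, rfl, ⟨ψ, hψ⟩, hp⟩
        have hp' : f (Φ (h a).1 a) = ψ := hp
        change f (Φ (h a).1 a) (h a).2 = j
        rw [hp', hψ]
    rw [this]
    exact MeasurableSet.iUnion fun p => (hhm p).inter
      (MeasurableSet.iUnion fun ψ => hΦ.meas p.1 (hfm ψ.1))
  have hc2 : ∀ x ∈ D, ∀ i, c2 (Θ i x) = f x i := by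
    intro x hx i
    have ha : ∃ p : ℕ × ι, Φ p.1 (Θ i x) ∈ D ∧ Θ p.2 (Φ p.1 (Θ i x)) = Θ i x := by
      obtain ⟨k, hk⟩ := (hΦ.reach _ _).1 (hΘG i x).symm
      exact ⟨(k, i), by rw [hk]; exact ⟨hx, rfl⟩⟩
    have h1 := hh _ ha
    have h2 : Φ (h (Θ i x)).1 (Θ i x) = x := by
      by_contra hne
      exact (hsep _ h1.1 x hx hne _ i).1 h1.2
    simp only [c2]
    rw [h2] at h1 ⊢
    exact (hfD x hx).2.2 _ _ h1.2
  refine ⟨fun a => if a ∈ A then c2 a else c1 a, Measurable.ite hA hc2m hc1m, ?_⟩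
  have hmix : ∀ x y, G.Adj x y → x ∈ A → y ∉ A → c2 x ≠ c1 y := by
    rintro x y hxy ⟨z, hz, i, rfl⟩ hy heq
    rw [hc2 z hz i] at heq
    exact (hfD z hz).1 i ⟨y, hxy, hy, heq.symm⟩
  rintro x y hxy ⟨z, hz, hxz⟩
  by_cases hx : x ∈ A
  · by_cases hy : y ∈ A
    · simp only [if_pos hx, if_pos hy]
      obtain ⟨u, hu, i, rfl⟩ := hx
      obtain ⟨v, hv, j, rfl⟩ := hy
      rw [hc2 u hu, hc2 v hv]
      by_cases huv : u = v
      · subst huv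
        exact (hfD u hu).2.1 i j hxy
      · exact absurd hxy (hsep u hu v hv huv i j).2
    · simp only [if_pos hx, if_neg hy]
      exact hmix x y hxy hx hy
  · by_cases hy : y ∈ A
    · simp only [if_neg hx, if_pos hy]
      exact (hmix y x hxy.symm hy hx).symm
    · simp only [if_neg hx, if_neg hy]
      exact hc1 x y hxy (hup x hx ⟨z, hz, hxz⟩) (hup y hy ⟨z, hz, hxy.symm.reachable.trans hxz⟩)

/-- The set of vertices whose component contains a finite extendable set has a Borel coloring. -/
lemma exists_measurable_coloring_of_extendable (hΦ : OrbitEnum G Φ) [NeZero d]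
    (hG : MeasurableSet {p : X × X | G.Adj p.1 p.2})
    (hdeg : ∀ x : X, (G.neighborSet x).encard ≤ (d : ℕ∞)) :
    ∃ Y : Set X, MeasurableSet Y ∧
      (∀ x, x ∈ Y ↔ ∃ S : Set X, S.Finite ∧ S.Nonempty ∧ (∀ y ∈ S, G.Reachable x y) ∧
        Extendable G d S) ∧
      ∃ c : X → Fin d, Measurable c ∧ ∀ x y, G.Adj x y → x ∈ Y → c x ≠ c y := by
  classical
  have hfin := fun x => Set.finite_of_encard_le_coe (hdeg x)
  let κ := {K : Finset ℕ // K.Nonempty}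
  have : Nonempty κ := ⟨{0}, Finset.singleton_nonempty 0⟩
  let S : κ → X → Set X := fun K x => Set.range fun i : K.1 => Φ i.1 x
  have hΦr : ∀ k x, G.Reachable x (Φ k x) := fun k x => (hΦ.reach _ _).2 ⟨k, rfl⟩
  let D : κ → Set X := fun K => {x | Extendable G d (S K x)}
  have hD : ∀ K, MeasurableSet (D K) := fun K =>
    measurableSet_extendable hG hdeg fun i => hΦ.meas i.1
  have hcol : ∀ K : κ, ∃ c0 : X → ℕ, Measurable c0 ∧ ∀ x y, x ≠ y → c0 x = c0 y →
      ∀ i j : K.1, Φ i x ≠ Φ j y ∧ ¬ G.Adj (Φ i x) (Φ j y) := by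
    intro K
    let R : X → X → Prop := fun x y => ∃ i j : K.1, Φ i x = Φ j y ∨ G.Adj (Φ i x) (Φ j y)
    have hRsymm : ∀ x y, R x y → R y x := by
      rintro x y ⟨i, j, h⟩
      exact ⟨j, i, h.imp Eq.symm SimpleGraph.Adj.symm⟩
    let C : SimpleGraph X :=
      { Adj := fun x y => x ≠ y ∧ R x y
        symm := ⟨fun x y h => ⟨h.1.symm, hRsymm x y h.2⟩⟩
        loopless := ⟨fun x h => h.1 rfl⟩ }
    have hex := exists_measurable_nat_coloring hΦ C ?_ ?_ ?_
    · obtain ⟨c, hc, hcp⟩ := hex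
      refine ⟨c, hc, fun x y hne hxy i j => ?_⟩
      by_contra hcon
      exact hcp x y ⟨hne, i, j, by tauto⟩ hxy
    · refine MeasurableSet.inter (measurableSet_eq_fun measurable_fst measurable_snd).compl ?_
      have : {p : X × X | R p.1 p.2} = ⋃ i : K.1, ⋃ j : K.1,
          ({p : X × X | Φ i p.1 = Φ j p.2} ∪ {p : X × X | G.Adj (Φ i p.1) (Φ j p.2)}) := by
        ext p
        simp only [Set.mem_iUnion]
        exact Iff.rfl
      change MeasurableSet {p : X × X | R p.1 p.2}
      rw [this]
      refine MeasurableSet.iUnion fun i => MeasurableSet.iUnion fun j => MeasurableSet.union ?_ ?_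
      · exact measurableSet_eq_fun ((hΦ.meas _).comp measurable_fst)
          ((hΦ.meas _).comp measurable_snd)
      · exact (((hΦ.meas i.1).comp measurable_fst).prodMk
          ((hΦ.meas j.1).comp measurable_snd)) hG
    · rintro x y ⟨-, i, j, h | h⟩
      · exact (hΦr i x).trans (h ▸ (hΦr j y).symm)
      · exact (hΦr i x).trans (h.reachable.trans (hΦr j y).symm)
    · intro x
      have h1 : (⋃ i : K.1, ⋃ j : K.1, ⋃ z ∈ insert (Φ i x) (G.neighborSet (Φ i x)),
          {y | Φ j y = z}).Finite :=
        Set.finite_iUnion fun i => Set.finite_iUnion fun j =>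
          ((hfin _).insert _).biUnion fun z _ => hΦ.finite_fiber j z
      refine h1.subset ?_
      rintro y ⟨-, i, j, h⟩
      simp only [Set.mem_iUnion]
      refine ⟨i, j, Φ j y, ?_, rfl⟩
      exact h.imp Eq.symm id
  choose c0 hc0m hc0 using hcol
  have hloc : ∀ p : κ × ℕ, ∃ c : X → Fin d, Measurable c ∧ ∀ x y, G.Adj x y →
      (∃ z ∈ D p.1 ∩ {z | c0 p.1 z = p.2}, G.Reachable x z) → c x ≠ c y := by
    rintro ⟨K, n⟩
    have : Nonempty K.1 := K.2.to_subtype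
    refine exists_measurable_coloring_of_separated_extendable hΦ hG hdeg
      (Θ := fun i : K.1 => Φ i.1) (fun i => hΦ.meas i.1) (fun i x => hΦr i x)
      ((hD K).inter (hc0m K (measurableSet_singleton n))) (fun x hx => hx.1) ?_
    intro x hx y hy hne i j
    exact hc0 K x y hne (hx.2.trans hy.2.symm) i j
  choose c hcm hcp using hloc
  let P : X → κ × ℕ → Prop := fun x p => ∃ z, z ∈ D p.1 ∩ {z | c0 p.1 z = p.2} ∧ G.Reachable x z
  have hreachm : MeasurableSet {p : X × X | G.Reachable p.1 p.2} := by
    have : {p : X × X | G.Reachable p.1 p.2} = ⋃ k, {p : X × X | Φ k p.1 = p.2} := by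
      ext p
      rw [Set.mem_iUnion]
      exact hΦ.reach _ _
    rw [this]
    exact MeasurableSet.iUnion fun k =>
      measurableSet_eq_fun ((hΦ.meas k).comp measurable_fst) measurable_snd
  have hP : ∀ p, MeasurableSet {x | P x p} := fun p =>
    hΦ.measurableSet_exists (g := fun x => x)
      (P := fun x z => z ∈ D p.1 ∩ {z | c0 p.1 z = p.2} ∧ G.Reachable x z) measurable_id
      ((measurable_snd ((hD p.1).inter (hc0m p.1 (measurableSet_singleton p.2)))).inter hreachm)
      fun x z h => h.2
  obtain ⟨f, hfm, hf, hf'⟩ := exists_measurable_choice P hP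
  refine ⟨{x | ∃ p, P x p}, ?_, ?_, fun x => c (f x) x, ?_, ?_⟩
  · have : {x | ∃ p, P x p} = ⋃ p, {x | P x p} := by
      ext x
      rw [Set.mem_iUnion]
      exact Iff.rfl
    rw [this]
    exact MeasurableSet.iUnion hP
  · intro x
    constructor
    · rintro ⟨⟨K, n⟩, z, ⟨hz, -⟩, hxz⟩
      have : Nonempty K.1 := K.2.to_subtype
      refine ⟨S K z, Set.finite_range _, Set.range_nonempty _, ?_, hz⟩
      rintro _ ⟨i, rfl⟩
      exact hxz.trans (hΦr i z)
    · rintro ⟨T, hT, hTne, hTx, hTe⟩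
      have h1 : ∀ y ∈ T, ∃ k, Φ k x = y := fun y hy => (hΦ.reach _ _).1 (hTx y hy)
      choose! k hk using h1
      have hK : (hT.toFinset.image k).Nonempty := by
        simpa using hTne
      have hS : S ⟨_, hK⟩ x = T := by
        ext y
        constructor
        · rintro ⟨⟨i, hi⟩, rfl⟩
          obtain ⟨y, hy, rfl⟩ := Finset.mem_image.1 hi
          have hy' := hT.mem_toFinset.1 hy
          change Φ (k y) x ∈ T
          rwa [hk y hy']
        · intro hy
          exact ⟨⟨k y, Finset.mem_image_of_mem k (hT.mem_toFinset.2 hy)⟩, hk y hy⟩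
      refine ⟨(⟨_, hK⟩, c0 ⟨_, hK⟩ x), x, ⟨?_, rfl⟩, SimpleGraph.Reachable.refl x⟩
      change Extendable G d (S ⟨_, hK⟩ x)
      rwa [hS]
  · refine measurable_to_countable' fun j => ?_
    have : (fun x => c (f x) x) ⁻¹' {j} = ⋃ p, {x | f x = p} ∩ c p ⁻¹' {j} := by
      ext x
      simp only [Set.mem_iUnion]
      constructor
      · intro hx
        exact ⟨f x, rfl, hx⟩
      · rintro ⟨p, rfl, hx⟩
        exact hx
    rw [this]
    exact MeasurableSet.iUnion fun p => (hfm p).inter (hcm p (measurableSet_singleton j))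
  · intro x y hxy hx
    have hxy' : f y = f x := hf' y x fun p => by
      constructor <;> rintro ⟨z, hz, hr⟩
      · exact ⟨z, hz, hxy.reachable.trans hr⟩
      · exact ⟨z, hz, hxy.symm.reachable.trans hr⟩
    simp only [hxy']
    exact hcp (f x) x y hxy (hf x hx)

end Gadget

section Within

variable {X : Type*} {G : SimpleGraph X}

/-- The graph on the same vertex set whose edges are those of `G` with both ends in `S`. -/
def within (G : SimpleGraph X) (S : Set X) : SimpleGraph X where
  Adj a b := G.Adj a b ∧ a ∈ S ∧ b ∈ S
  symm := ⟨fun _ _ h => ⟨h.1.symm, h.2.2, h.2.1⟩⟩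
  loopless := ⟨fun _ h => h.1.ne rfl⟩

lemma within_le (G : SimpleGraph X) (S : Set X) : within G S ≤ G := fun _ _ h => h.1

lemma within_mono (G : SimpleGraph X) {S T : Set X} (h : S ⊆ T) : within G S ≤ within G T :=
  fun _ _ hab => ⟨hab.1, h hab.2.1, h hab.2.2⟩

lemma reachable_within_of_walk {S : Set X} {a b : X} (p : G.Walk a b)
    (h : ∀ v ∈ p.support, v ∈ S) : (within G S).Reachable a b := by
  induction p with
  | nil => exact SimpleGraph.Reachable.refl _
  | cons hadj p ih =>
    simp only [SimpleGraph.Walk.support_cons, List.mem_cons, forall_eq_or_imp] at h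
    exact (SimpleGraph.Adj.reachable (G := within G S) ⟨hadj, h.1, h.2 _ p.start_mem_support⟩).trans
      (ih h.2)

lemma support_subset_of_walk_within {S : Set X} {a b : X} (p : (within G S).Walk a b)
    (ha : a ∈ S) : ∀ v ∈ p.support, v ∈ S := by
  induction p with
  | nil => simpa using ha
  | cons hadj p ih =>
    simp only [SimpleGraph.Walk.support_cons, List.mem_cons, forall_eq_or_imp]
    exact ⟨ha, ih hadj.2.2⟩

lemma mem_of_reachable_within {S : Set X} {a b : X} (h : (within G S).Reachable a b)
    (ha : a ∈ S) : b ∈ S := by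
  obtain ⟨p⟩ := h
  exact support_subset_of_walk_within p ha _ p.end_mem_support

/-- Paths of `G` inside `S` from reachability in `within G S`. -/
lemma exists_path_of_reachable_within {S : Set X} {a b : X} (h : (within G S).Reachable a b)
    (ha : a ∈ S) : ∃ p : G.Walk a b, p.IsPath ∧ ∀ v ∈ p.support, v ∈ S := by
  obtain ⟨p, hp⟩ := h.exists_isPath
  refine ⟨p.mapLe (within_le G S), (SimpleGraph.Walk.isPath_mapLe _).2 hp, fun v hv => ?_⟩
  rw [SimpleGraph.Walk.support_mapLe_eq_support] at hv
  exact support_subset_of_walk_within p ha v hv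

/-- A set any two points of which are joined by a path inside the set. -/
def Conn (G : SimpleGraph X) (S : Set X) : Prop :=
  ∀ x ∈ S, ∀ y ∈ S, (within G S).Reachable x y

/-- A connected set without cut points. -/
def BiConn (G : SimpleGraph X) (S : Set X) : Prop :=
  Conn G S ∧ ∀ v, Conn G (S \ {v})

/-- List colorability of the induced subgraph on `S`. -/
def ListColorable {d : ℕ} (G : SimpleGraph X) (L : X → Set (Fin d)) (S : Set X) : Prop :=
  ∃ c : X → Fin d, ∀ v ∈ S, c v ∈ L v ∧ ∀ u ∈ S, G.Adj u v → c u ≠ c v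

lemma ListColorable.insert {d : ℕ} {L : X → Set (Fin d)} {S : Set X} {s : X} {c : X → Fin d}
    (hc : ∀ v ∈ S \ {s}, c v ∈ L v ∧ ∀ u ∈ S \ {s}, G.Adj u v → c u ≠ c v) (hs : s ∈ S) {j : Fin d}
    (hj : j ∈ L s) (hne : ∀ v ∈ S, G.Adj s v → c v ≠ j) : ListColorable G L S := by
  classical
  refine ⟨fun v => if v = s then j else c v, fun v hv => ?_⟩
  by_cases hvs : v = s
  · subst hvs
    refine ⟨by simpa using hj, fun u hu huv => ?_⟩
    have : u ≠ v := huv.ne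
    simpa [this] using hne u hu huv.symm
  · refine ⟨by simpa [hvs] using (hc v ⟨hv, hvs⟩).1, fun u hu huv => ?_⟩
    by_cases hus : u = s
    · subst hus
      simpa [hvs] using (hne v hv huv).symm
    · simpa [hvs, hus] using (hc v ⟨hv, hvs⟩).2 u ⟨hu, hus⟩ huv

lemma encard_neighbor_diff_lt {S : Set X} (hS : S.Finite) {u v : X} (hv : v ∈ S)
    (h : G.Adj u v) : (G.neighborSet u ∩ (S \ {v})).encard < (G.neighborSet u ∩ S).encard := by
  refine Set.Finite.encard_lt_encard (hS.subset fun x hx => hx.2.1) ⟨fun x hx => ⟨hx.1, hx.2.1⟩, ?_⟩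
  intro hsub
  exact (hsub ⟨h, hv⟩).2.2 rfl

lemma encard_neighbor_diff_le (G : SimpleGraph X) (S : Set X) (u v : X) :
    (G.neighborSet u ∩ (S \ {v})).encard ≤ (G.neighborSet u ∩ S).encard :=
  Set.encard_le_encard fun _ hx => ⟨hx.1, hx.2.1⟩

/-- If every vertex of a finite set has a list at least as large as its degree, and is connected
to a vertex with a longer list, then the set is list colorable. -/
lemma listColorable_of_slack {d : ℕ} [NeZero d] (L : X → Set (Fin d)) {S : Set X} (hS : S.Finite)
    (hL : ∀ v ∈ S, (G.neighborSet v ∩ S).encard ≤ (L v).encard)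
    (hslack : ∀ v ∈ S, ∃ s ∈ S, (within G S).Reachable v s ∧
      (G.neighborSet s ∩ S).encard < (L s).encard) : ListColorable G L S := by
  obtain ⟨n, hn⟩ : ∃ n, n = S.ncard := ⟨_, rfl⟩
  induction n generalizing S with
  | zero =>
    rw [eq_comm, Set.ncard_eq_zero hS] at hn
    subst hn
    exact ⟨fun _ => 0, fun v hv => absurd hv (Set.notMem_empty v)⟩
  | succ n ih =>
    obtain ⟨v, hv⟩ : S.Nonempty := by
      rw [← Set.ncard_pos hS]
      omega
    obtain ⟨s, hs, -, hsl⟩ := hslack v hv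
    have key : ∀ u t, (within G S).Reachable u t → u ∈ S → u ≠ s →
        (G.neighborSet t ∩ S).encard < (L t).encard → ∃ t' ∈ S \ {s},
        (within G (S \ {s})).Reachable u t' ∧
        (G.neighborSet t' ∩ (S \ {s})).encard < (L t').encard := by
      rintro u t ⟨p⟩ hu hus ht
      induction p with
      | nil => exact ⟨_, ⟨hu, hus⟩, SimpleGraph.Reachable.refl _,
          (encard_neighbor_diff_le _ _ _ _).trans_lt ht⟩
      | @cons u w t hadj p ih' =>
        by_cases hw : w = s
        · subst hw
          exact ⟨u, ⟨hu, hus⟩, SimpleGraph.Reachable.refl _,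
            (encard_neighbor_diff_lt hS hs hadj.1).trans_le (hL u hu)⟩
        · obtain ⟨t', h1, h2, h3⟩ := ih' hadj.2.2 hw ht
          refine ⟨t', h1, SimpleGraph.Reachable.trans ?_ h2, h3⟩
          exact SimpleGraph.Adj.reachable (G := within G (S \ {s}))
            ⟨hadj.1, ⟨hu, hus⟩, hadj.2.2, hw⟩
    obtain ⟨c, hc⟩ := ih (S := S \ {s}) hS.sdiff
      (fun v hv => (encard_neighbor_diff_le _ _ _ _).trans (hL v hv.1))
      (fun u hu => by
        obtain ⟨t, -, h2, h3⟩ := hslack u hu.1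
        exact key u t h2 hu.1 hu.2 h3)
      (by rw [Set.ncard_sdiff_singleton_of_mem hs]; omega)
    obtain ⟨j, hj, hjn⟩ : ∃ j ∈ L s, j ∉ c '' (G.neighborSet s ∩ S) := by
      by_contra! hcon
      exact absurd ((Set.encard_le_encard hcon).trans (Set.encard_image_le c _)) (not_le.2 hsl)
    exact ListColorable.insert hc hs hj fun v hv hsv heq => hjn ⟨v, ⟨hsv, hv⟩, heq⟩

/-- In a finite set without cut points which is not colorable from lists of the size of the
degrees, all degrees are equal. -/
lemma BiConn.encard_eq_of_not_listColorable {d : ℕ} [NeZero d] {L : X → Set (Fin d)} {S : Set X}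
    (hB : BiConn G S) (hS : S.Finite)
    (hL : ∀ v ∈ S, (G.neighborSet v ∩ S).encard ≤ (L v).encard)
    (hcol : ¬ ListColorable G L S) {u v : X} (hu : u ∈ S) (hv : v ∈ S) :
    (G.neighborSet u ∩ S).encard = (G.neighborSet v ∩ S).encard := by
  classical
  have heq : ∀ v ∈ S, (G.neighborSet v ∩ S).encard = (L v).encard := by
    intro v hv
    refine (hL v hv).eq_of_not_lt fun hlt => hcol ?_
    exact listColorable_of_slack L hS hL fun w hw => ⟨v, hv, hB.1 w hw v hv, hlt⟩
  have hsub : ∀ u v, G.Adj u v → u ∈ S → v ∈ S → L v ⊆ L u := by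
    intro u v huv hu hv j hj
    by_contra hju
    let L' : X → Set (Fin d) := fun w => if G.Adj v w then L w \ {j} else L w
    have hL' : ∀ w ∈ S \ {v}, (G.neighborSet w ∩ (S \ {v})).encard ≤ (L' w).encard := by
      intro w hw
      by_cases hvw : G.Adj v w
      · simp only [L', if_pos hvw]
        have h1 := encard_neighbor_diff_lt hS hv hvw.symm
        rw [heq w hw.1] at h1
        refine le_trans ?_ (Set.encard_tsub_one_le_encard_sdiff_singleton _ _)
        exact ENat.le_sub_of_add_le_right (by simp) (Order.add_one_le_of_lt h1)
      · simp only [L', if_neg hvw]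
        exact (encard_neighbor_diff_le _ _ _ _).trans (hL w hw.1)
    have huS : u ∈ S \ {v} := ⟨hu, huv.ne⟩
    have hsl : (G.neighborSet u ∩ (S \ {v})).encard < (L' u).encard := by
      simp only [L', if_pos huv.symm]
      rw [Set.sdiff_singleton_eq_self hju, ← heq u hu]
      exact encard_neighbor_diff_lt hS hv huv
    obtain ⟨c, hc⟩ := listColorable_of_slack L' hS.sdiff hL' fun w hw =>
      ⟨u, huS, hB.2 v w hw u huS, hsl⟩
    refine hcol (ListColorable.insert (c := c) (fun w hw => ⟨?_, (hc w hw).2⟩) hv hj ?_)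
    · have := (hc w hw).1
      simp only [L'] at this
      split_ifs at this
      · exact this.1
      · exact this
    · intro w hw hvw heq
      have := (hc w ⟨hw, hvw.ne'⟩).1
      simp only [L', if_pos hvw] at this
      exact this.2 heq
  rw [heq u hu, heq v hv]
  congr 1
  obtain ⟨p⟩ := hB.1 u hu v hv
  clear hv
  induction p with
  | nil => rfl
  | cons hadj p ih =>
    exact (Set.Subset.antisymm (hsub _ _ hadj.1.symm hadj.2.2 hadj.2.1)
      (hsub _ _ hadj.1 hadj.2.1 hadj.2.2)).trans (ih hadj.2.2)

end Within

section Brooks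

variable {X : Type*} {G : SimpleGraph X}

lemma within_reachable_mono {S T : Set X} (h : S ⊆ T) {a b : X}
    (hab : (within G S).Reachable a b) : (within G T).Reachable a b :=
  hab.mono (within_mono G h)

/-- Adding an ear preserves the absence of cut points. -/
lemma BiConn.union_support {T : Set X} (hT : BiConn G T) {a b : X} (ha : a ∈ T) (hb : b ∈ T)
    (p : G.Walk a b) (hp : p.IsPath) : BiConn G (T ∪ {v | v ∈ p.support}) := by
  classical
  have key : ∀ v, ∀ w ∈ (T ∪ {v | v ∈ p.support}) \ {v}, ∃ t ∈ T \ {v},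
      (within G ((T ∪ {v | v ∈ p.support}) \ {v})).Reachable w t := by
    rintro v w ⟨hw | hw, hwv⟩
    · exact ⟨w, ⟨hw, hwv⟩, SimpleGraph.Reachable.refl _⟩
    · have hw : w ∈ p.support := hw
      have hsp := p.take_spec hw
      have h1 : ∀ x ∈ (p.takeUntil w hw).support, x ∈ p.support :=
        fun x hx => p.support_takeUntil_subset_support hw hx
      have h2 : ∀ x ∈ (p.dropUntil w hw).support, x ∈ p.support :=
        fun x hx => p.support_dropUntil_subset_support hw hx
      by_cases hv1 : v ∈ (p.takeUntil w hw).support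
      · have hv2 : v ∉ (p.dropUntil w hw).support := by
          intro hv2
          have hnd := hp.support_nodup
          rw [← hsp, SimpleGraph.Walk.support_append, List.nodup_append] at hnd
          rw [SimpleGraph.Walk.mem_support_iff] at hv2
          rcases hv2 with h | h
          · exact hwv h.symm
          · exact hnd.2.2 v hv1 v h rfl
        refine ⟨b, ⟨hb, ?_⟩, reachable_within_of_walk (p.dropUntil w hw) fun x hx =>
          ⟨Or.inr (h2 x hx), ?_⟩⟩
        · rintro rfl
          exact hv2 (SimpleGraph.Walk.end_mem_support _)
        · rintro rfl
          exact hv2 hx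
      · refine ⟨a, ⟨ha, ?_⟩, reachable_within_of_walk (p.takeUntil w hw).reverse fun x hx => ?_⟩
        · rintro rfl
          exact hv1 (SimpleGraph.Walk.start_mem_support _)
        · rw [SimpleGraph.Walk.support_reverse, List.mem_reverse] at hx
          refine ⟨Or.inr (h1 x hx), ?_⟩
          rintro rfl
          exact hv1 hx
  have h2 : ∀ v, Conn G ((T ∪ {v | v ∈ p.support}) \ {v}) := by
    intro v x hx y hy
    obtain ⟨s, hs, hxs⟩ := key v x hx
    obtain ⟨t, ht, hyt⟩ := key v y hy
    exact hxs.trans ((within_reachable_mono (Set.sdiff_subset_sdiff_left Set.subset_union_left)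
      (hT.2 v s hs t ht)).trans hyt.symm)
  have h1 : ∀ w ∈ T ∪ {v | v ∈ p.support}, ∃ t ∈ T,
      (within G (T ∪ {v | v ∈ p.support})).Reachable w t := by
    rintro w (hw | hw)
    · exact ⟨w, hw, SimpleGraph.Reachable.refl _⟩
    · have hw : w ∈ p.support := hw
      exact ⟨b, hb, reachable_within_of_walk (p.dropUntil w hw) fun x hx =>
        Or.inr (p.support_dropUntil_subset_support hw hx)⟩
  refine ⟨fun x hx y hy => ?_, h2⟩
  obtain ⟨s, hs, hxs⟩ := h1 x hx
  obtain ⟨t, ht, hyt⟩ := h1 y hy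
  exact hxs.trans ((within_reachable_mono Set.subset_union_left (hT.1 s hs t ht)).trans hyt.symm)

lemma biConn_pair {a b : X} (hab : G.Adj a b) : BiConn G {a, b} := by
  have h : (within G {a, b}).Adj a b := ⟨hab, by simp, by simp⟩
  constructor
  · rintro x (rfl | rfl) y (rfl | rfl)
    · exact SimpleGraph.Reachable.refl _
    · exact h.reachable
    · exact h.symm.reachable
    · exact SimpleGraph.Reachable.refl _
  · rintro v x hx y hy
    by_cases hxy : x = y
    · subst hxy
      exact SimpleGraph.Reachable.refl _
    have : (within G ({a, b} \ {v})).Adj x y := by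
      refine ⟨?_, hx, hy⟩
      rcases hx.1 with rfl | rfl <;> rcases hy.1 with rfl | rfl
      · exact absurd rfl hxy
      · exact hab
      · exact hab.symm
      · exact absurd rfl hxy
    exact this.reachable

/-- Leaving the set `P` inside a connected set. -/
lemma Conn.exists_adj_of_mem_of_notMem {S P : Set X} (hS : Conn G S) {x y : X} (hx : x ∈ S)
    (hy : y ∈ S) (hxP : x ∈ P) (hyP : y ∉ P) : ∃ u ∈ S, ∃ v ∈ S, u ∈ P ∧ v ∉ P ∧ G.Adj u v := by
  obtain ⟨p⟩ := hS x hx y hy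
  obtain ⟨e, -, h1, h2⟩ := p.exists_boundary_dart P hxP hyP
  exact ⟨_, e.adj.2.1, _, e.adj.2.2, h1, h2, e.adj.1⟩

/-- Two distinct vertices of a proper subset with at least two points of a set without cut points
are joined by a path through the complement of the subset. -/
lemma BiConn.exists_ear {S T : Set X} (hS : BiConn G S) (hTS : T ⊂ S) (hT : T.Nontrivial) :
    ∃ (a b p q : X), a ∈ T ∧ b ∈ T ∧ a ≠ b ∧ p ∈ S \ T ∧ G.Adj a p ∧ G.Adj q b ∧
      (within G (S \ T)).Reachable p q := by
  obtain ⟨w, hwS, hwT⟩ := Set.exists_of_ssubset hTS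
  let P : Set X := {p | (within G (S \ T)).Reachable w p}
  have hPS : P ⊆ S \ T := fun p hp => mem_of_reachable_within hp ⟨hwS, hwT⟩
  have hwP : w ∈ P := SimpleGraph.Reachable.refl _
  have key : ∀ {u v}, u ∈ P → v ∉ P → v ∈ S → G.Adj u v → v ∈ T := by
    intro u v hu hv hvS huv
    by_contra hvT
    exact hv (SimpleGraph.Reachable.trans (show (within G (S \ T)).Reachable w u from hu)
      (SimpleGraph.Adj.reachable (G := within G (S \ T)) ⟨huv, hPS hu, hvS, hvT⟩))
  obtain ⟨t, ht⟩ := hT.nonempty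
  obtain ⟨p, -, a, haS, hpP, haP, hpa⟩ := hS.1.exists_adj_of_mem_of_notMem hwS (hTS.1 ht) hwP
    fun h => (hPS h).2 ht
  have haT := key hpP haP haS hpa
  obtain ⟨t', ht', hta⟩ := hT.exists_ne a
  obtain ⟨q, -, b, hbS, hqP, hbP, hqb⟩ := (hS.2 a).exists_adj_of_mem_of_notMem (x := w) (y := t')
    ⟨hwS, fun h => hwT (h ▸ haT)⟩ ⟨hTS.1 ht', hta⟩ hwP fun h => (hPS h).2 ht'
  exact ⟨a, b, p, q, haT, key hqP hbP hbS.1 hqb, fun h => hbS.2 h.symm, hPS hpP, hpa.symm, hqb,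
    (show (within G (S \ T)).Reachable w p from hpP).symm.trans hqP⟩

/-- A finite regular graph of degree at least three without cut points, all of whose subsets without
cut points are regular, is complete. -/
lemma BiConn.isClique {S : Set X} (hS : BiConn G S) (hfin : S.Finite) {d : ℕ} (hd : 3 ≤ d)
    (hreg : ∀ T ⊆ S, BiConn G T → ∀ u ∈ T, ∀ v ∈ T,
      (G.neighborSet u ∩ T).encard = (G.neighborSet v ∩ T).encard)
    (hne : S.Nonempty) (hdeg : ∀ v ∈ S, (G.neighborSet v ∩ S).encard = d) :
    S.encard = d + 1 ∧ G.IsClique S := by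
  classical
  obtain ⟨x, hx⟩ := hne
  obtain ⟨T, hTmax⟩ : ∃ T, Maximal (fun T => T ⊂ S ∧ T.Nontrivial ∧ BiConn G T) T := by
    have hfinT : {T | T ⊂ S ∧ T.Nontrivial ∧ BiConn G T}.Finite :=
      hfin.finite_subsets.subset fun T hT => hT.1.1
    refine hfinT.exists_maximal ?_
    have h0 : 1 < (G.neighborSet x ∩ S).encard := by
      rw [hdeg x hx]
      exact_mod_cast (by omega : 1 < d)
    obtain ⟨y, hy, z, hz, hyz⟩ := Set.one_lt_encard_iff_nontrivial.1 h0
    have hxy : G.Adj x y := hy.1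
    have hxz : G.Adj x z := hz.1
    refine ⟨{x, y}, ⟨?_, ?_⟩, ⟨x, by simp, y, by simp, hxy.ne⟩, biConn_pair hxy⟩
    · rintro v (rfl | rfl)
      · exact hx
      · exact hy.2
    · intro hsub
      rcases hsub hz.2 with h | h
      · exact hxz.ne' h
      · exact hyz h.symm
  obtain ⟨⟨hTS, hTn, hTB⟩, hmax⟩ := hTmax
  have hex : ∃ n : ℕ, ∃ (a b p q : X), a ∈ T ∧ b ∈ T ∧ a ≠ b ∧ p ∈ S \ T ∧ G.Adj a p ∧ G.Adj q b ∧
      ∃ w : (within G (S \ T)).Walk p q, w.IsPath ∧ w.length = n := by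
    obtain ⟨a, b, p, q, h1, h2, h3, h4, h5, h6, h7⟩ := hS.exists_ear hTS hTn
    obtain ⟨w, hw⟩ := h7.exists_isPath
    exact ⟨_, a, b, p, q, h1, h2, h3, h4, h5, h6, w, hw, rfl⟩
  obtain ⟨a, b, p, q, ha, hb, hab, hp, hap, hqb, w, hw, hlen⟩ := Nat.find_spec hex
  have hmin : ∀ {a b p q : X}, a ∈ T → b ∈ T → a ≠ b → p ∈ S \ T → G.Adj a p → G.Adj q b →
      ∀ w' : (within G (S \ T)).Walk p q, w.length ≤ w'.length := by
    intro a b p q ha hb hab hp hap hqb w'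
    rw [hlen]
    exact (Nat.find_min' hex ⟨a, b, p, q, ha, hb, hab, hp, hap, hqb, w'.bypass,
      w'.bypass_isPath, rfl⟩).trans w'.length_bypass_le_length
  clear hlen hex
  have hwS : ∀ v ∈ w.support, v ∈ S \ T := support_subset_of_walk_within w hp
  have hST : S = T ∪ {v | v ∈ w.support} := by
    let w1 : G.Walk p q := w.mapLe (within_le G _)
    have hw1s : w1.support = w.support := SimpleGraph.Walk.support_mapLe_eq_support _ _
    have hw1 : w1.IsPath := (SimpleGraph.Walk.isPath_mapLe _).2 hw
    let e : G.Walk a b := SimpleGraph.Walk.cons hap (w1.concat hqb)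
    have hes : e.support = a :: (w.support ++ [b]) := by
      simp [e, SimpleGraph.Walk.support_concat, hw1s]
    have he : e.IsPath := by
      rw [SimpleGraph.Walk.isPath_def, hes, List.nodup_cons, List.nodup_append]
      refine ⟨?_, hw.support_nodup, List.nodup_singleton b, ?_⟩
      · rw [List.mem_append, List.mem_singleton]
        rintro (h | h)
        · exact (hwS a h).2 ha
        · exact hab h
      · rintro v hv u hu rfl
        rw [List.mem_singleton] at hu
        subst hu
        exact (hwS v hv).2 hb
    have hunion : T ∪ {v | v ∈ e.support} = T ∪ {v | v ∈ w.support} := by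
      ext v
      change (v ∈ T ∨ v ∈ e.support) ↔ (v ∈ T ∨ v ∈ w.support)
      rw [hes, List.mem_cons, List.mem_append, List.mem_singleton]
      constructor
      · rintro (h | rfl | h | rfl)
        · exact Or.inl h
        · exact Or.inl ha
        · exact Or.inr h
        · exact Or.inl hb
      · rintro (h | h)
        · exact Or.inl h
        · exact Or.inr (Or.inr (Or.inl h))
    have hB := hTB.union_support ha hb e he
    rw [hunion] at hB
    have hsubS : T ∪ {v | v ∈ w.support} ⊆ S := Set.union_subset hTS.1 fun v hv => (hwS v hv).1
    by_contra hne
    have := hmax ⟨⟨hsubS, fun h => hne (h.antisymm hsubS)⟩, hTn.mono Set.subset_union_left, hB⟩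
      Set.subset_union_left
    exact hp.2 (this (Or.inr w.start_mem_support))
  have hout : ∀ t ∈ T, ∃ v ∈ w.support, G.Adj t v := by
    intro t ht
    by_contra! hcon
    have h1 : (G.neighborSet t ∩ T).encard = (G.neighborSet t ∩ S).encard := by
      congr 1
      ext v
      constructor
      · exact fun h => ⟨h.1, hTS.1 h.2⟩
      · rintro ⟨h1, h2⟩
        rw [hST] at h2
        exact ⟨h1, h2.resolve_right fun h => hcon v h h1⟩
    have h2 : (G.neighborSet a ∩ T).encard < (G.neighborSet a ∩ S).encard := by
      refine Set.Finite.encard_lt_encard (hfin.subset fun v hv => hTS.1 hv.2)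
        ⟨fun v hv => ⟨hv.1, hTS.1 hv.2⟩, fun h => ?_⟩
      exact hp.2 (h ⟨hap, hp.1⟩).2
    rw [hreg T hTS.1 hTB a ha t ht, h1, hdeg t (hTS.1 ht), hdeg a (hTS.1 ha)] at h2
    exact lt_irrefl _ h2
  cases w with
  | nil =>
    have hSp : S = insert p T := by
      rw [hST]
      ext v
      simp [or_comm]
    have hNp : G.neighborSet p ∩ S = T := by
      ext v
      constructor
      · rintro ⟨h1, h2⟩
        rw [hSp] at h2
        exact h2.resolve_left fun h => G.ne_of_adj h1 h.symm
      · intro hv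
        obtain ⟨u, hu, hvu⟩ := hout v hv
        rw [SimpleGraph.Walk.support_nil, List.mem_singleton] at hu
        subst hu
        exact ⟨hvu.symm, hTS.1 hv⟩
    have hcard : S.encard = d + 1 := by
      rw [hSp, Set.encard_insert_of_notMem hp.2, ← hNp, hdeg p hp.1]
    refine ⟨hcard, fun u hu v hv huv => ?_⟩
    have h1 : G.neighborSet u ∩ S = S \ {u} := by
      refine Set.Finite.eq_of_subset_of_encard_le (hfin.subset Set.inter_subset_right)
        (fun v hv => ⟨hv.2, fun h => G.ne_of_adj hv.1 h.symm⟩) ?_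
      rw [hdeg u hu]
      have := Set.encard_sdiff_singleton_add_one hu
      rw [hcard] at this
      exact (ENat.add_left_injective_of_ne_top ENat.one_ne_top this).le
    exact (h1.symm.subset ⟨hv, huv.symm⟩ : v ∈ G.neighborSet u ∩ S).1
  | @cons _ r _ hadj w' =>
    exfalso
    have hr : ∀ t ∈ T, t ≠ b → ∀ v ∈ w'.support, ¬ G.Adj t v := by
      intro t ht htb v hv htv
      have h1 := hmin ht hb htb (hwS v (List.mem_cons_of_mem _ hv)) htv hqb (w'.dropUntil v hv)
      have h2 := w'.length_dropUntil_le_length hv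
      rw [SimpleGraph.Walk.length_cons] at h1
      omega
    have hpa : ∀ t ∈ T, G.Adj t p → t = a := by
      intro t ht htp
      by_contra hne
      have h1 := hmin ha ht (Ne.symm hne) hp hap htp.symm SimpleGraph.Walk.nil
      rw [SimpleGraph.Walk.length_cons, SimpleGraph.Walk.length_nil] at h1
      omega
    have hsub : G.neighborSet a ∩ S ⊆ {p, b} := by
      rintro v ⟨hav, hvS⟩
      rw [hST] at hvS
      rcases hvS with hv | hv
      · right
        by_contra hvb
        obtain ⟨u, hu, hvu⟩ := hout v hv
        rw [SimpleGraph.Walk.support_cons, List.mem_cons] at hu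
        rcases hu with rfl | hu
        · exact G.ne_of_adj hav (hpa v hv hvu).symm
        · exact hr v hv hvb u hu hvu
      · have hv : v ∈ (SimpleGraph.Walk.cons hadj w').support := hv
        rw [SimpleGraph.Walk.support_cons, List.mem_cons] at hv
        rcases hv with rfl | hv
        · exact Or.inl rfl
        · exact absurd hav (hr a ha hab v hv)
    have h1 := (Set.encard_le_encard hsub).trans (Set.encard_insert_le _ _)
    rw [hdeg a (hTS.1 ha), Set.encard_singleton] at h1
    have : d ≤ 1 + 1 := by exact_mod_cast h1
    omega

end Brooks

section Hard

variable {X : Type*} {G : SimpleGraph X} {d : ℕ}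

/-- An invariant set on which no finite set can be colored greedily at the end. -/
structure Hard (G : SimpleGraph X) (d : ℕ) (U : Set X) : Prop where
  mem_of_reachable : ∀ x ∈ U, ∀ y, G.Reachable x y → y ∈ U
  not_extendable : ∀ x ∈ U, ∀ S : Set X, S.Finite → S.Nonempty → (∀ y ∈ S, G.Reachable x y) →
    ¬ Extendable G d S

variable {U : Set X}

lemma Hard.encard_neighborSet (hU : Hard G d U) (hdeg : ∀ x, (G.neighborSet x).encard ≤ (d : ℕ∞))
    {x : X} (hx : x ∈ U) : (G.neighborSet x).encard = d := by
  refine (hdeg x).eq_of_not_lt fun hlt => hU.not_extendable x hx {x} (Set.finite_singleton x)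
    (Set.singleton_nonempty x) (by rintro y rfl; exact SimpleGraph.Reachable.refl _) ?_
  intro L hL
  have h1 := hL x rfl
  have h2 : (L x).Nonempty := by
    rw [Set.nonempty_iff_ne_empty]
    intro h0
    rw [h0, Set.encard_empty, zero_add] at h1
    exact (h1.trans (Set.encard_le_encard Set.sdiff_subset)).not_gt hlt
  obtain ⟨j, hj⟩ := h2
  refine ⟨fun _ => j, ?_⟩
  rintro v rfl
  exact ⟨hj, by rintro u rfl h; exact absurd rfl h.ne⟩

lemma Hard.regular [NeZero d] (hU : Hard G d U)
    (hdeg : ∀ x, (G.neighborSet x).encard ≤ (d : ℕ∞)) {S : Set X} (hSU : S ⊆ U) (hS : S.Finite)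
    (hB : BiConn G S) {u v : X} (hu : u ∈ S) (hv : v ∈ S) :
    (G.neighborSet u ∩ S).encard = (G.neighborSet v ∩ S).encard := by
  have hne := hU.not_extendable u (hSU hu) S hS ⟨u, hu⟩
    fun y hy => (hB.1 u hu y hy).mono (within_le G S)
  unfold Extendable at hne
  push Not at hne
  obtain ⟨L, hL, hcol⟩ := hne
  refine hB.encard_eq_of_not_listColorable (L := L) hS (fun w hw => ?_) ?_ hu hv
  · have h1 := hL w hw
    have hfin : (G.neighborSet w \ S).encard ≠ ⊤ :=
      ((Set.encard_le_encard Set.sdiff_subset).trans_lt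
        ((hdeg w).trans_lt (ENat.natCast_lt_top d))).ne
    rw [← hU.encard_neighborSet hdeg (hSU hw), ← Set.encard_sdiff_add_encard_inter _ S,
      add_comm] at h1
    exact (ENat.add_le_add_iff_right hfin).1 h1
  · rintro ⟨c, hc⟩
    obtain ⟨w, hw, h⟩ := hcol c
    obtain ⟨t, ht, hadj, heq⟩ := h (hc w hw).1
    exact (hc w hw).2 t ht hadj heq

/-- Every vertex of a hard set is a cut point. -/
lemma Hard.exists_not_reachable (hU : Hard G d U) (hd : 3 ≤ d)
    (hdeg : ∀ x, (G.neighborSet x).encard ≤ (d : ℕ∞)) (hclique : G.CliqueFree (d + 1)) {x : X}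
    (hx : x ∈ U) : ∃ y z, G.Adj x y ∧ G.Adj x z ∧ ¬ (within G {x}ᶜ).Reachable y z := by
  classical
  have : NeZero d := ⟨by omega⟩
  by_contra! hcon
  have hN := hU.encard_neighborSet hdeg hx
  have hNfin : (G.neighborSet x).Finite := Set.finite_of_encard_eq_coe hN
  have hNne : (G.neighborSet x).Nonempty := by
    rw [← Set.encard_ne_zero, hN]
    exact_mod_cast (by omega : d ≠ 0)
  obtain ⟨y₀, hy₀⟩ := hNne
  have key : ∀ F : Set X, F.Finite → F ⊆ G.neighborSet x →
      ∃ T : Set X, T.Finite ∧ BiConn G T ∧ T ⊆ U ∧ x ∈ T ∧ y₀ ∈ T ∧ F ⊆ T := by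
    intro F hF
    induction F, hF using Set.Finite.induction_on with
    | empty =>
      refine fun _ => ⟨{x, y₀}, Set.toFinite _, biConn_pair hy₀, ?_, by simp, by simp,
        Set.empty_subset _⟩
      rintro v (rfl | rfl)
      · exact hx
      · exact hU.mem_of_reachable x hx _ (SimpleGraph.Adj.reachable hy₀)
    | @insert y F hyF hF ih =>
      intro hsub
      obtain ⟨T, hT, hB, hTU, hxT, hyT, hFT⟩ := ih ((Set.subset_insert _ _).trans hsub)
      have hxy : G.Adj x y := hsub (Set.mem_insert _ _)
      obtain ⟨p, hp, hps⟩ := exists_path_of_reachable_within (hcon y₀ y hy₀ hxy)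
        (G.ne_of_adj hy₀).symm
      have hp' : (p.concat hxy.symm).IsPath := hp.concat (fun h => hps x h rfl) hxy.symm
      refine ⟨_, hT.union (List.finite_toSet (p.concat hxy.symm).support),
        hB.union_support hyT hxT (p.concat hxy.symm) hp', ?_, Or.inl hxT, Or.inl hyT, ?_⟩
      · rintro v (hv | hv)
        · exact hTU hv
        · exact hU.mem_of_reachable y₀ (hTU hyT) v
            ((p.concat hxy.symm).takeUntil v hv).reachable
      · rintro v (rfl | hv)
        · right
          change v ∈ (p.concat hxy.symm).support
          rw [SimpleGraph.Walk.support_concat]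
          simp
        · exact Or.inl (hFT hv)
  obtain ⟨T, hT, hB, hTU, hxT, -, hNT⟩ := key _ hNfin subset_rfl
  have hdegT : ∀ v ∈ T, (G.neighborSet v ∩ T).encard = d := by
    intro v hv
    rw [hU.regular hdeg hTU hT hB hv hxT, Set.inter_eq_left.2 hNT, hN]
  obtain ⟨hcard, hcl⟩ := hB.isClique hT hd (fun S hS hBS u hu v hv =>
    hU.regular hdeg (hS.trans hTU) (hT.subset hS) hBS hu hv) ⟨x, hxT⟩ hdegT
  refine hclique hT.toFinset ⟨by simpa using hcl, ?_⟩
  have h := hT.encard_eq_coe_toFinset_card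
  rw [hcard] at h
  exact_mod_cast h.symm

/-- Hard sets are colorable, without regard to measurability. -/
lemma Hard.exists_coloring (hU : Hard G d U) (hd : 3 ≤ d)
    (hdeg : ∀ x, (G.neighborSet x).encard ≤ (d : ℕ∞)) (hclique : G.CliqueFree (d + 1)) :
    ∃ c : X → Fin d, ∀ x y, G.Adj x y → x ∈ U → c x ≠ c y := by
  classical
  let r : X → X := fun x => (G.connectedComponentMk x).out
  have hr : ∀ x, G.Reachable (r x) x := fun x =>
    SimpleGraph.ConnectedComponent.exact (Quot.out_eq (G.connectedComponentMk x))
  have hrr : ∀ x y, G.Adj x y → r x = r y := fun x y h => by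
    simp only [r]
    rw [SimpleGraph.ConnectedComponent.sound h.reachable]
  have key : ∀ x ∈ U, ∃ z, G.Adj x z ∧ G.dist (r x) x < G.dist (r z) z := by
    intro x hx
    obtain ⟨y, z, hxy, hxz, hyz⟩ := hU.exists_not_reachable hd hdeg hclique hx
    have : ∃ w, G.Adj x w ∧ ∀ p : G.Walk (r x) w, x ∈ p.support := by
      by_contra! hcon
      obtain ⟨p, hp⟩ := hcon y hxy
      obtain ⟨q, hq⟩ := hcon z hxz
      refine hyz (SimpleGraph.Reachable.trans (v := r x) ?_ ?_)
      · exact (reachable_within_of_walk p fun v hv => by rintro rfl; exact hp hv).symm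
      · exact reachable_within_of_walk q fun v hv => by rintro rfl; exact hq hv
    obtain ⟨w, hxw, hw⟩ := this
    refine ⟨w, hxw, ?_⟩
    rw [← hrr x w hxw]
    obtain ⟨p, hp⟩ := ((hr x).trans hxw.reachable).exists_walk_length_eq_dist
    have h1 := SimpleGraph.dist_le (p.takeUntil x (hw p))
    have h2 : (p.takeUntil x (hw p)).length < p.length :=
      SimpleGraph.Walk.length_takeUntil_lt_length (hw p) hxw.ne
    omega
  obtain ⟨c, hc⟩ := exists_coloring_of_rank (by omega) hdeg fun x => G.dist (r x) x
  refine ⟨c, fun x y hxy hx => hc x y hxy (key x hx) (key y ?_)⟩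
  exact hU.mem_of_reachable x hx y hxy.reachable

end Hard

section Forest

variable {X : Type*} {G : SimpleGraph X}

/-- The weight of a pair of vertices. -/
noncomputable def wt (e : X → ℝ) (a b : X) : ℝ ×ₗ ℝ := toLex (min (e a) (e b), max (e a) (e b))

lemma wt_comm (e : X → ℝ) (a b : X) : wt e a b = wt e b a := by
  rw [wt, wt, min_comm, max_comm]

lemma wt_inj {e : X → ℝ} (he : e.Injective) {a b u v : X} (h : wt e a b = wt e u v) :
    s(a, b) = s(u, v) := by
  have h1 : min (e a) (e b) = min (e u) (e v) := congrArg (fun p => (ofLex p).1) h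
  have h2 : max (e a) (e b) = max (e u) (e v) := congrArg (fun p => (ofLex p).2) h
  rw [Sym2.eq_iff]
  rcases le_total (e a) (e b) with h3 | h3 <;> rcases le_total (e u) (e v) with h4 | h4 <;>
    simp only [min_eq_left, min_eq_right, max_eq_left, max_eq_right, h3, h4] at h1 h2
  · exact Or.inl ⟨he h1, he h2⟩
  · exact Or.inr ⟨he h1, he h2⟩
  · exact Or.inr ⟨he h2, he h1⟩
  · exact Or.inl ⟨he h2, he h1⟩

/-- The edges of weight less than `t`. -/
def light (G : SimpleGraph X) (e : X → ℝ) (t : ℝ ×ₗ ℝ) : SimpleGraph X where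
  Adj a b := G.Adj a b ∧ wt e a b < t
  symm := ⟨fun a b h => ⟨h.1.symm, by rw [wt_comm]; exact h.2⟩⟩
  loopless := ⟨fun _ h => h.1.ne rfl⟩

lemma light_le (G : SimpleGraph X) (e : X → ℝ) (t : ℝ ×ₗ ℝ) : light G e t ≤ G := fun _ _ h => h.1

/-- The free minimal spanning forest: the edges that are not heaviest in a cycle. -/
def msf (G : SimpleGraph X) (e : X → ℝ) : SimpleGraph X where
  Adj a b := G.Adj a b ∧ ¬ (light G e (wt e a b)).Reachable a b
  symm := ⟨fun a b h => ⟨h.1.symm, fun h' => h.2 (by rw [wt_comm]; exact h'.symm)⟩⟩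
  loopless := ⟨fun _ h => h.1.ne rfl⟩

lemma msf_le (G : SimpleGraph X) (e : X → ℝ) : msf G e ≤ G := fun _ _ h => h.1

lemma msf_isAcyclic {e : X → ℝ} (he : e.Injective) : (msf G e).IsAcyclic := by
  intro v c hc
  have hne : {δ | δ ∈ c.darts}.Nonempty := by
    rcases c with _ | ⟨h, p⟩
    · exact absurd rfl hc.ne_nil
    · exact ⟨_, List.mem_cons_self⟩
  obtain ⟨δ, hδ, hmax⟩ := Set.exists_max_image {δ | δ ∈ c.darts}
    (fun δ => wt e δ.fst δ.snd) (List.finite_toSet _) hne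
  let H : SimpleGraph X := SimpleGraph.fromEdgeSet {a | a ∈ c.edges}
  have hH : ∀ a ∈ c.edges, a ∈ H.edgeSet := by
    intro a ha
    rw [SimpleGraph.edgeSet_fromEdgeSet]
    exact ⟨ha, SimpleGraph.not_isDiag_of_mem_edgeSet _ (c.edges_subset_edgeSet ha)⟩
  have hδe : s(δ.fst, δ.snd) ∈ c.edges := by
    rw [SimpleGraph.Walk.edges, List.mem_map]
    exact ⟨δ, hδ, rfl⟩
  have hbr : ¬ H.IsBridge s(δ.fst, δ.snd) := by
    rw [SimpleGraph.isBridge_iff_forall_cycle_notMem (hH _ hδe)]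
    intro hcon
    refine hcon (c.transfer H hH) (hc.transfer hH) ?_
    rw [SimpleGraph.Walk.edges_transfer]
    exact hδe
  rw [SimpleGraph.isBridge_iff, not_not] at hbr
  refine δ.adj.2 (hbr.mono ?_)
  intro a b hab
  rw [SimpleGraph.deleteEdges_adj, SimpleGraph.fromEdgeSet_adj] at hab
  obtain ⟨⟨h1, -⟩, h2⟩ := hab
  have h1 : s(a, b) ∈ c.edges := h1
  refine ⟨(c.edges_subset_edgeSet h1 : (msf G e).Adj a b).1, ?_⟩
  rw [SimpleGraph.Walk.edges, List.mem_map] at h1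
  obtain ⟨ε, hε, hab⟩ := h1
  have h3 : wt e a b = wt e ε.fst ε.snd := by
    have h4 : s(ε.fst, ε.snd) = s(a, b) := hab
    rw [Sym2.eq_iff] at h4
    rcases h4 with ⟨h, h'⟩ | ⟨h, h'⟩
    · rw [h, h']
    · rw [h, h', wt_comm]
  have h4 := hmax ε hε
  refine lt_of_le_of_ne (h3.trans_le h4) fun h => h2 ?_
  exact wt_inj he h

/-- The first step of a light path from one end of an edge to the other. -/
lemma exists_light_step {e : X → ℝ} {x y : X} {t : ℝ ×ₗ ℝ} (hxy : x ≠ y)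
    (h : (light G e t).Reachable x y) : ∃ z, G.Adj x z ∧ wt e x z < t ∧
      ∃ p : (light G e t).Walk z y, p.IsPath ∧ x ∉ p.support := by
  obtain ⟨p, hp⟩ := h.exists_isPath
  cases p with
  | nil => exact absurd rfl hxy
  | @cons _ z _ hadj q =>
    rw [SimpleGraph.Walk.cons_isPath_iff] at hp
    exact ⟨z, hadj.1, hadj.2, q, hp.1, hp.2⟩

lemma reachable_within_of_light {e : X → ℝ} {y z : X} {t : ℝ ×ₗ ℝ} {S : Set X}
    (p : (light G e t).Walk z y) (hp : ∀ v ∈ p.support, v ∈ S) : (within G S).Reachable z y :=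
  reachable_within_of_walk (p.mapLe (light_le G e t)) (by
    rwa [SimpleGraph.Walk.support_mapLe_eq_support])

lemma msf_adj_of_min {e : X → ℝ} {x y : X} (hxy : G.Adj x y)
    (hmin : ∀ z, G.Adj x z → (within G {x}ᶜ).Reachable z y → wt e x y ≤ wt e x z) :
    (msf G e).Adj x y := by
  refine ⟨hxy, fun h => ?_⟩
  obtain ⟨z, hxz, hlt, p, -, hxp⟩ := exists_light_step hxy.ne h
  exact (hmin z hxz (reachable_within_of_light p fun v hv => by rintro rfl; exact hxp hv)).not_gt hlt

lemma exists_msf_adj (e : X → ℝ) {x y : X} (hfin : (G.neighborSet x).Finite) (hxy : G.Adj x y) :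
    ∃ z, (msf G e).Adj x z ∧ (within G {x}ᶜ).Reachable y z := by
  obtain ⟨z, ⟨hxz, hz⟩, hmin⟩ := Set.exists_min_image
    {z | G.Adj x z ∧ (within G {x}ᶜ).Reachable y z} (fun z => wt e x z)
    (hfin.subset fun z hz => hz.1) ⟨y, hxy, SimpleGraph.Reachable.refl _⟩
  exact ⟨z, msf_adj_of_min hxz fun w hw hwz => hmin w ⟨hw, hz.trans hwz.symm⟩, hz⟩

/-- The cut property for the edges near an edge `xy` that return to it. -/
lemma msf_adj_of_min_pair {e : X → ℝ} {x y z : X} (hxy : G.Adj x y) (hyz : G.Adj y z)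
    (hzx : z ≠ x) (hz : (within G {y}ᶜ).Reachable z x)
    (hmin₁ : ∀ w, G.Adj y w → w ≠ x → (within G {y}ᶜ).Reachable w x → wt e y z ≤ wt e y w)
    (hmin₂ : ∀ w, G.Adj x w → w ≠ y → (within G {x}ᶜ).Reachable w y → wt e y z ≤ wt e x w) :
    (msf G e).Adj y z := by
  refine ⟨hyz, fun h => ?_⟩
  obtain ⟨w, hyw, hlt, p, hp, hyp⟩ := exists_light_step hyz.ne h
  have hwz : (within G {y}ᶜ).Reachable w z :=
    reachable_within_of_light p fun v hv => by rintro rfl; exact hyp hv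
  by_cases hwx : w = x
  · subst hwx
    cases p with
    | nil => exact hzx rfl
    | @cons _ u _ hadj q =>
      rw [SimpleGraph.Walk.cons_isPath_iff] at hp
      rw [SimpleGraph.Walk.support_cons, List.mem_cons, not_or] at hyp
      refine (hmin₂ u hadj.1 ?_ ?_).not_gt hadj.2
      · rintro rfl
        exact hyp.2 q.start_mem_support
      · refine SimpleGraph.Reachable.trans (v := z) (reachable_within_of_light q fun v hv => ?_) ?_
        · rintro rfl
          exact hp.2 hv
        · exact SimpleGraph.Adj.reachable (G := within G {w}ᶜ)
            ⟨hyz.symm, fun h => hp.2 (h ▸ q.end_mem_support), hyp.1⟩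
  · exact (hmin₁ w hyw hwx (hwz.trans hz)).not_gt hlt

variable {d : ℕ} {U : Set X}

lemma Hard.exists_two_msf_adj (hU : Hard G d U) (hd : 3 ≤ d)
    (hdeg : ∀ x, (G.neighborSet x).encard ≤ (d : ℕ∞)) (hclique : G.CliqueFree (d + 1))
    (e : X → ℝ) {x : X} (hx : x ∈ U) : ∃ y z, (msf G e).Adj x y ∧ (msf G e).Adj x z ∧
      ¬ (within G {x}ᶜ).Reachable y z := by
  obtain ⟨y, z, hxy, hxz, hyz⟩ := hU.exists_not_reachable hd hdeg hclique hx
  have hfin := Set.finite_of_encard_le_coe (hdeg x)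
  obtain ⟨y', hy', hyy'⟩ := exists_msf_adj e hfin hxy
  obtain ⟨z', hz', hzz'⟩ := exists_msf_adj e hfin hxz
  exact ⟨y', z', hy', hz', fun h => hyz (hyy'.trans (h.trans hzz'.symm))⟩

lemma three_le_encard_of_ne {S : Set X} {a b c : X} (ha : a ∈ S) (hb : b ∈ S) (hc : c ∈ S)
    (hab : a ≠ b) (hac : a ≠ c) (hbc : b ≠ c) : 3 ≤ S.encard := by
  rw [← Set.encard_eq_three.2 ⟨a, b, c, hab, hac, hbc, rfl⟩]
  refine Set.encard_le_encard ?_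
  rintro v (rfl | rfl | rfl) <;> assumption

/-- In the minimal spanning forest, a vertex of a hard set of degree less than three has a neighbor
of degree at least three. -/
lemma Hard.exists_msf_adj_three_le (hU : Hard G d U) (hd : 3 ≤ d)
    (hdeg : ∀ x, (G.neighborSet x).encard ≤ (d : ℕ∞)) (hclique : G.CliqueFree (d + 1))
    (e : X → ℝ) {x : X} (hx : x ∈ U) (h3 : ¬ 3 ≤ ((msf G e).neighborSet x).encard) :
    ∃ y, (msf G e).Adj x y ∧ 3 ≤ ((msf G e).neighborSet y).encard := by
  obtain ⟨y₁, y₂, h1, h2, h12⟩ := hU.exists_two_msf_adj hd hdeg hclique e hx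
  have hne12 : y₁ ≠ y₂ := by rintro rfl; exact h12 (SimpleGraph.Reachable.refl _)
  have honly : ∀ z, (msf G e).Adj x z → z = y₁ ∨ z = y₂ := by
    intro z hz
    by_contra! hcon
    exact h3 (three_le_encard_of_ne h1 h2 hz hne12 hcon.1.symm hcon.2.symm)
  have hfin : ∀ v, (G.neighborSet v).Finite := fun v => Set.finite_of_encard_le_coe (hdeg v)
  obtain ⟨u, hxu, hu1, hu2⟩ : ∃ u, G.Adj x u ∧ u ≠ y₁ ∧ u ≠ y₂ := by
    by_contra! hcon
    have hsub : G.neighborSet x ⊆ {y₁, y₂} := by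
      intro u hu
      by_cases h : u = y₁
      · exact Or.inl h
      · exact Or.inr (hcon u hu h)
    have h := (Set.encard_le_encard hsub).trans (Set.encard_insert_le _ _)
    rw [hU.encard_neighborSet hdeg hx, Set.encard_singleton] at h
    have : d ≤ 1 + 1 := by exact_mod_cast h
    omega
  obtain ⟨y, hxy, huy⟩ := exists_msf_adj e (hfin x) hxu
  have huy' : u ≠ y := by rcases honly y hxy with rfl | rfl <;> assumption
  have hsame : ∀ z, (msf G e).Adj x z → (within G {x}ᶜ).Reachable z y → z = y := by
    intro z hz hzy
    rcases honly z hz with rfl | rfl <;> rcases honly y hxy with rfl | rfl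
    · rfl
    · exact absurd hzy h12
    · exact absurd hzy.symm h12
    · rfl
  refine ⟨y, hxy, ?_⟩
  have hGxy := hxy.1
  let E₁ : Set X := {w | G.Adj y w ∧ w ≠ x ∧ (within G {y}ᶜ).Reachable w x}
  let E₂ : Set X := {w | G.Adj x w ∧ w ≠ y ∧ (within G {x}ᶜ).Reachable w y}
  obtain ⟨z₂, hz₂, hmin₂⟩ := Set.exists_min_image E₂ (fun w => wt e x w)
    ((hfin x).subset fun w hw => hw.1) ⟨u, hxu, huy', huy⟩
  have hE₁ : ∃ z ∈ E₁, (msf G e).Adj y z := by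
    by_cases hcase : ∃ w ∈ E₁, wt e y w ≤ wt e x z₂
    · obtain ⟨w, hw, hwz⟩ := hcase
      obtain ⟨z₁, hz₁, hmin₁⟩ := Set.exists_min_image E₁ (fun w => wt e y w)
        ((hfin y).subset fun w hw => hw.1) ⟨w, hw⟩
      refine ⟨z₁, hz₁, msf_adj_of_min_pair hGxy hz₁.1 hz₁.2.1 hz₁.2.2 (fun w h1 h2 h3 =>
        hmin₁ w ⟨h1, h2, h3⟩) fun v h1 h2 h3 => ?_⟩
      exact (hmin₁ w hw).trans (hwz.trans (hmin₂ v ⟨h1, h2, h3⟩))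
    · push Not at hcase
      refine absurd (hsame z₂ (msf_adj_of_min_pair hGxy.symm hz₂.1 hz₂.2.1 hz₂.2.2 (fun w h1 h2 h3 =>
        hmin₂ w ⟨h1, h2, h3⟩) fun v h1 h2 h3 => (hcase v ⟨h1, h2, h3⟩).le) hz₂.2.2) hz₂.2.1
  obtain ⟨z, hz, hyz⟩ := hE₁
  have hyU : y ∈ U := hU.mem_of_reachable x hx y hGxy.reachable
  obtain ⟨w, hyw, hwx⟩ : ∃ w, (msf G e).Adj y w ∧ ¬ (within G {y}ᶜ).Reachable w x := by
    obtain ⟨a, b, ha, hb, hab⟩ := hU.exists_two_msf_adj hd hdeg hclique e hyU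
    by_contra! hcon
    exact hab ((hcon a ha).trans (hcon b hb).symm)
  refine three_le_encard_of_ne (a := x) (b := z) (c := w) hxy.symm hyz hyw hz.2.1.symm ?_ ?_
  · rintro rfl
    exact hwx (SimpleGraph.Reachable.refl _)
  · rintro rfl
    exact hwx hz.2.2

lemma measurableSet_msf_adj [MeasurableSpace X] [StandardBorelSpace X] {Φ : ℕ → X → X}
    (hΦ : OrbitEnum G Φ) (hG : MeasurableSet {p : X × X | G.Adj p.1 p.2}) {e : X → ℝ}
    (he : Measurable e) : MeasurableSet {p : X × X | (msf G e).Adj p.1 p.2} := by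
  have hR : MeasurableSet {p : (X × X) × X × X |
      (light G e (wt e p.1.1 p.1.2)).Adj p.2.1 p.2.2} := by
    have h1 : MeasurableSet {p : (X × X) × X × X | G.Adj p.2.1 p.2.2} := measurable_snd hG
    have e1 : Measurable fun p : (X × X) × X × X => e p.1.1 := by fun_prop
    have e2 : Measurable fun p : (X × X) × X × X => e p.1.2 := by fun_prop
    have e3 : Measurable fun p : (X × X) × X × X => e p.2.1 := by fun_prop
    have e4 : Measurable fun p : (X × X) × X × X => e p.2.2 := by fun_prop
    have h2 := measurableSet_lt (e3.min e4) (e1.min e2)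
    have h3 := measurableSet_eq_fun (e3.min e4) (e1.min e2)
    have h4 := measurableSet_lt (e3.max e4) (e1.max e2)
    convert h1.inter (h2.union (h3.inter h4)) using 1
    ext p
    exact and_congr_right fun _ => Prod.Lex.toLex_lt_toLex
  have h := hΦ.measurableSet_reflTransGen (Z := X × X)
    (R := fun z => (light G e (wt e z.1 z.2)).Adj) hR fun z a b h => h.1.reachable
  have hdiag : Measurable fun p : X × X => (p, p) := measurable_id.prodMk measurable_id
  convert hG.inter (hdiag h).compl using 1
  ext p
  refine and_congr_right fun _ => not_congr ?_
  exact SimpleGraph.reachable_iff_reflTransGen _ _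

end Forest

section Leads

variable {X : Type*} {H : SimpleGraph X}

/-- Following the edge from `x` to `y` and continuing along vertices of degree two, the first vertex
of degree at least three is `v`. -/
inductive Leads (H : SimpleGraph X) : X → X → X → Prop
  | branch {x y : X} : H.Adj x y → 3 ≤ (H.neighborSet y).encard → Leads H x y y
  | step {x y z v : X} : H.Adj x y → ¬ 3 ≤ (H.neighborSet y).encard → H.Adj y z → z ≠ x →
      Leads H y z v → Leads H x y v

lemma Leads.adj {x y v : X} (h : Leads H x y v) : H.Adj x y := by
  cases h <;> assumption

lemma Leads.three_le {x y v : X} (h : Leads H x y v) : 3 ≤ (H.neighborSet v).encard := by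
  induction h <;> assumption

lemma eq_of_not_three_le {x y z w : X} (hy : ¬ 3 ≤ (H.neighborSet y).encard) (hxy : H.Adj x y)
    (hz : H.Adj y z) (hw : H.Adj y w) (hzx : z ≠ x) (hwx : w ≠ x) : z = w := by
  by_contra h
  exact hy (three_le_encard_of_ne hxy.symm hz hw hzx.symm hwx.symm h)

lemma Leads.unique {x y v w : X} (h : Leads H x y v) (h' : Leads H x y w) : v = w := by
  induction h with
  | branch _ h3 =>
    cases h' with
    | branch => rfl
    | step _ h3' => exact absurd h3 h3'
  | step hxy h3 hyz hzx _ ih =>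
    cases h' with
    | branch _ h3' => exact absurd h3' h3
    | step _ _ hyz' hzx' h'' =>
      obtain rfl := eq_of_not_three_le h3 hxy hyz hyz' hzx hzx'
      exact ih h''

lemma Leads.exists_isPath (hH : H.IsAcyclic) {x y v : X} (h : Leads H x y v) :
    ∃ q : H.Walk y v, (SimpleGraph.Walk.cons h.adj q).IsPath ∧
      ∀ w ∈ q.support, w = v ∨ ¬ 3 ≤ (H.neighborSet w).encard := by
  simp only [hH.isPath_iff_isChain]
  induction h with
  | branch hxy h3 => exact ⟨SimpleGraph.Walk.nil, by simp, by simp⟩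
  | @step x y z v hxy h3 hyz hzx hl ih =>
    obtain ⟨q, hq, hqs⟩ := ih
    refine ⟨SimpleGraph.Walk.cons hyz q, ?_, ?_⟩
    · rw [SimpleGraph.Walk.edges_cons, SimpleGraph.Walk.edges_cons, List.isChain_cons_cons]
      refine ⟨?_, by rwa [SimpleGraph.Walk.edges_cons] at hq⟩
      intro heq
      rw [Sym2.eq_swap, Sym2.congr_right] at heq
      exact hzx heq.symm
    · intro w hw
      rw [SimpleGraph.Walk.support_cons, List.mem_cons] at hw
      rcases hw with rfl | hw
      · exact Or.inr h3
      · exact hqs w hw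

lemma leads_of_isPath {x y v : X} (hxy : H.Adj x y) (q : H.Walk y v)
    (hq : (SimpleGraph.Walk.cons hxy q).IsPath)
    (hqs : ∀ w ∈ q.support, w = v ∨ ¬ 3 ≤ (H.neighborSet w).encard)
    (hv : 3 ≤ (H.neighborSet v).encard) : Leads H x y v := by
  induction q generalizing x with
  | nil => exact Leads.branch hxy hv
  | @cons y z v hyz q ih =>
    rw [SimpleGraph.Walk.cons_isPath_iff] at hq
    have hq1 := hq.1
    rw [SimpleGraph.Walk.cons_isPath_iff] at hq1
    have hyv : y ≠ v := fun h => hq1.2 (h ▸ q.end_mem_support)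
    refine Leads.step hxy ((hqs y (SimpleGraph.Walk.start_mem_support _)).resolve_left hyv) hyz ?_
      (ih hyz hq.1 (fun w hw => hqs w ?_) hv)
    · rintro rfl
      exact hq.2 (List.mem_cons_of_mem _ q.start_mem_support)
    · exact List.mem_cons_of_mem _ hw

lemma Leads.ne (hH : H.IsAcyclic) {x y v : X} (h : Leads H x y v) : x ≠ v := by
  obtain ⟨q, hq, -⟩ := h.exists_isPath hH
  rw [SimpleGraph.Walk.cons_isPath_iff] at hq
  rintro rfl
  exact hq.2 q.end_mem_support

lemma Leads.exists_reverse (hH : H.IsAcyclic) {x y v : X} (h : Leads H x y v)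
    (hx : 3 ≤ (H.neighborSet x).encard) : ∃ t, Leads H v t x := by
  obtain ⟨q, hq, hqs⟩ := h.exists_isPath hH
  have hne := h.ne hH
  have hr := hq.reverse
  have hs : ∀ w ∈ (SimpleGraph.Walk.cons h.adj q).reverse.support,
      w = x ∨ w = v ∨ ¬ 3 ≤ (H.neighborSet w).encard := by
    intro w hw
    rw [SimpleGraph.Walk.support_reverse, List.mem_reverse, SimpleGraph.Walk.support_cons,
      List.mem_cons] at hw
    exact hw.imp_right (hqs w)
  generalize (SimpleGraph.Walk.cons h.adj q).reverse = r at hr hs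
  cases r with
  | nil => exact absurd rfl hne
  | cons hvt r =>
    refine ⟨_, leads_of_isPath hvt r hr (fun w hw => ?_) hx⟩
    rw [SimpleGraph.Walk.cons_isPath_iff] at hr
    rcases hs w (List.mem_cons_of_mem _ hw) with h | rfl | h
    · exact Or.inl h
    · exact absurd hw hr.2
    · exact Or.inr h

lemma Leads.reachable_within (hH : H.IsAcyclic) {x y v u : X} (h : Leads H x y v)
    (hu : 3 ≤ (H.neighborSet u).encard) (huv : u ≠ v) : (within H {u}ᶜ).Reachable y v := by
  obtain ⟨q, -, hqs⟩ := h.exists_isPath hH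
  refine reachable_within_of_walk q fun w hw => ?_
  rintro rfl
  rcases hqs w hw with h | h
  · exact huv h
  · exact h hu

/-- In a forest, two neighbors of a vertex are separated by it. -/
lemma eq_of_isAcyclic (hH : H.IsAcyclic) {x y z : X} (hxy : H.Adj x y) (hxz : H.Adj x z)
    (h : (within H {x}ᶜ).Reachable y z) : y = z := by
  obtain ⟨q, hq, hqs⟩ := exists_path_of_reachable_within h (SimpleGraph.ne_of_adj _ hxy).symm
  have h1 : (SimpleGraph.Walk.cons hxy q).IsPath :=
    (SimpleGraph.Walk.cons_isPath_iff _ _).2 ⟨hq, fun h => hqs x h rfl⟩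
  have h2 : hxz.toWalk.IsPath := SimpleGraph.Walk.IsPath.of_adj hxz
  have h3 := congrArg (fun p : H.Path x z => p.1.length)
    ((hH.subsingleton_path x z).elim ⟨_, h1⟩ ⟨_, h2⟩)
  simp only [SimpleGraph.Walk.length_cons, SimpleGraph.Walk.length_nil,
    SimpleGraph.Adj.toWalk] at h3
  exact SimpleGraph.Walk.eq_of_length_eq_zero (p := q) (by omega)

lemma Leads.eq_of_leads (hH : H.IsAcyclic) {x y y' v : X} (hx : 3 ≤ (H.neighborSet x).encard)
    (h : Leads H x y v) (h' : Leads H x y' v) : y = y' :=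
  eq_of_isAcyclic hH h.adj h'.adj ((h.reachable_within hH hx (h.ne hH)).trans
    (h'.reachable_within hH hx (h.ne hH)).symm)

lemma Leads.not_triangle (hH : H.IsAcyclic) {u w v s r y : X}
    (hu : 3 ≤ (H.neighborSet u).encard) (huw : Leads H u s w) (huv : Leads H u r v)
    (hwv : Leads H w y v) : False := by
  obtain ⟨t, ht⟩ := huw.exists_reverse hH hu
  have hw := huw.three_le
  have h1 := ht.reachable_within hH hw (huw.ne hH).symm
  have h2 := hwv.reachable_within hH hw (hwv.ne hH)
  have h3 := huv.reachable_within hH hw (hwv.ne hH)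
  have h4 : (within H {w}ᶜ).Adj u r :=
    ⟨huv.adj, huw.ne hH, mem_of_reachable_within h3.symm (hwv.ne hH).symm⟩
  obtain rfl := eq_of_isAcyclic hH ht.adj hwv.adj
    (h1.trans (h4.reachable.trans (h3.trans h2.symm)))
  exact huv.ne hH (ht.unique hwv)

/-- Two branching vertices joined by a path of vertices of degree two. -/
def Linked (H : SimpleGraph X) (u v : X) : Prop :=
  3 ≤ (H.neighborSet u).encard ∧ ∃ y, Leads H u y v

lemma Linked.symm (hH : H.IsAcyclic) {u v : X} (h : Linked H u v) : Linked H v u := by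
  obtain ⟨hu, y, hy⟩ := h
  exact ⟨hy.three_le, hy.exists_reverse hH hu⟩

lemma encard_linked_le (H : SimpleGraph X) (u : X) :
    {v | Linked H u v}.encard ≤ (H.neighborSet u).encard := by
  classical
  let f : X → X := fun y => if h : ∃ v, Leads H u y v then h.choose else u
  refine (Set.encard_le_encard ?_).trans (Set.encard_image_le f _)
  rintro v ⟨-, y, hy⟩
  refine ⟨y, hy.adj, ?_⟩
  have h : ∃ v, Leads H u y v := ⟨v, hy⟩
  simp only [f, dif_pos h]
  exact h.choose_spec.unique hy

/-- Distinct vertices at distance at most three with respect to `Linked`. -/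
def conflict (H : SimpleGraph X) (hH : H.IsAcyclic) : SimpleGraph X where
  Adj u v := u ≠ v ∧ ∃ a b, (u = a ∨ Linked H u a) ∧ (a = b ∨ Linked H a b) ∧ (b = v ∨ Linked H b v)
  symm := ⟨fun _ _ ⟨h, a, b, h1, h2, h3⟩ => ⟨h.symm, b, a, h3.imp Eq.symm (Linked.symm hH),
    h2.imp Eq.symm (Linked.symm hH), h1.imp Eq.symm (Linked.symm hH)⟩⟩
  loopless := ⟨fun _ h => h.1 rfl⟩

lemma encard_conflict_lt (hH : H.IsAcyclic) {d : ℕ}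
    (hdeg : ∀ x, (H.neighborSet x).encard ≤ (d : ℕ∞)) (u : X) :
    ((conflict H hH).neighborSet u).encard < ((d + 1) ^ 3 + 1 : ℕ) := by
  have hF : ∀ a, ∃ f : Fin (d + 1) → X, ∀ v, (a = v ∨ Linked H a v) → ∃ i, f i = v := by
    intro a
    let S : Set X := insert a {v | Linked H a v}
    have hS : S.encard ≤ (d + 1 : ℕ) := by
      refine (Set.encard_insert_le _ _).trans ?_
      push_cast
      gcongr
      exact (encard_linked_le H a).trans (hdeg a)
    have hfin : S.Finite := Set.finite_of_encard_le_coe hS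
    have : Fintype S := hfin.fintype
    have hcard : Fintype.card S ≤ Fintype.card (Fin (d + 1)) := by
      rw [Fintype.card_fin]
      rw [← Set.coe_fintypeCard] at hS
      exact_mod_cast hS
    obtain ⟨g⟩ := Function.Embedding.nonempty_of_card_le hcard
    have : Nonempty S := ⟨⟨a, Or.inl rfl⟩⟩
    refine ⟨fun i => (Function.invFun g i : S), fun v hv => ?_⟩
    have hvS : v ∈ S := hv.imp Eq.symm id
    exact ⟨g ⟨v, hvS⟩,
      congrArg Subtype.val (Function.leftInverse_invFun g.injective ⟨v, hvS⟩)⟩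
  choose f hf using hF
  let F : Fin (d + 1) × Fin (d + 1) × Fin (d + 1) → X := fun i => f (f (f u i.1) i.2.1) i.2.2
  have hsub : (conflict H hH).neighborSet u ⊆ Set.range F := by
    rintro v ⟨-, a, b, h1, h2, h3⟩
    obtain ⟨i, rfl⟩ := hf _ _ h1
    obtain ⟨j, rfl⟩ := hf _ _ h2
    obtain ⟨k, rfl⟩ := hf _ _ h3
    exact ⟨(i, j, k), rfl⟩
  refine (Set.encard_le_encard hsub).trans_lt ?_
  rw [← Set.image_univ]
  refine (Set.encard_image_le _ _).trans_lt ?_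
  rw [Set.encard_univ, ENat.card_eq_coe_fintype_card]
  simp only [Fintype.card_prod, Fintype.card_fin]
  exact_mod_cast (by ring_nf; omega)

end Leads

section Star

variable {X : Type*} {H : SimpleGraph X} {A D : Set X}

/-- A graph on `A` of minimal degree two, in which every edge leads to a branching vertex. -/
structure Good (H : SimpleGraph X) (A : Set X) : Prop where
  mem : ∀ x y, H.Adj x y → x ∈ A
  two_le : ∀ x ∈ A, 2 ≤ (H.neighborSet x).encard
  exists_leads : ∀ x y, H.Adj x y → ∃ v, Leads H x y v

/-- The set `D` together with the adjacent segments of vertices of degree two. -/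
def star (H : SimpleGraph X) (D : Set X) : Set X :=
  D ∪ {x | ¬ 3 ≤ (H.neighborSet x).encard ∧ ∃ y v, Leads H x y v ∧ v ∈ D}

/-- A set of pairwise non-conflicting branching vertices. -/
structure Separated (H : SimpleGraph X) (hH : H.IsAcyclic) (D : Set X) : Prop where
  three_le : ∀ x ∈ D, 3 ≤ (H.neighborSet x).encard
  not_adj : ∀ x ∈ D, ∀ y ∈ D, ¬ (conflict H hH).Adj x y

lemma Good.exists_adj (hg : Good H A) {x : X} (hx : x ∈ A) : ∃ y, H.Adj x y := by
  have h : (H.neighborSet x).Nonempty := by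
    rw [← Set.encard_pos]
    exact lt_of_lt_of_le (by norm_num) (hg.two_le x hx)
  exact h

lemma Good.mem_of_three_le (hg : Good H A) {x : X} (hx : 3 ≤ (H.neighborSet x).encard) : x ∈ A := by
  have h : (H.neighborSet x).Nonempty := by
    rw [← Set.encard_pos]
    exact lt_of_lt_of_le (by norm_num) hx
  obtain ⟨y, hy⟩ := h
  exact hg.mem x y hy

lemma Leads.reachable (hH : H.IsAcyclic) {x y v : X} (h : Leads H x y v) : H.Reachable x v := by
  obtain ⟨q, -⟩ := h.exists_isPath hH
  exact h.adj.reachable.trans q.reachable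

variable {hH : H.IsAcyclic}

lemma Separated.eq_of_linked (hD : Separated H hH D) {u v w : X} (hv : v ∈ D) (hw : w ∈ D)
    (huv : Linked H u v) (huw : Linked H u w) : v = w := by
  by_contra hne
  exact hD.not_adj v hv w hw ⟨hne, u, w, Or.inr (huv.symm hH), Or.inr huw, Or.inl rfl⟩

lemma Good.exists_reachable_sdiff_star (hg : Good H A) (hD : Separated H hH D) {x : X}
    (hx : x ∈ A) : ∃ b ∈ A \ star H D, H.Reachable x b := by
  have key : ∀ v ∈ D, ∃ b ∈ A \ star H D, H.Reachable v b := by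
    intro v hv
    have hv3 := hD.three_le v hv
    obtain ⟨y, hy⟩ := hg.exists_adj (hg.mem_of_three_le hv3)
    obtain ⟨w, hw⟩ := hg.exists_leads v y hy
    refine ⟨w, ⟨hg.mem_of_three_le hw.three_le, ?_⟩, hw.reachable hH⟩
    rintro (h | h)
    · exact hD.not_adj v hv w h ⟨hw.ne hH, w, w, Or.inr ⟨hv3, y, hw⟩, Or.inl rfl, Or.inl rfl⟩
    · exact h.1 hw.three_le
  by_cases hxS : x ∈ star H D
  · rcases hxS with h | ⟨-, y, v, hl, hv⟩
    · exact key x h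
    · obtain ⟨b, hb, hvb⟩ := key v hv
      exact ⟨b, hb, (hl.reachable hH).trans hvb⟩
  · exact ⟨x, ⟨hx, hxS⟩, SimpleGraph.Reachable.refl _⟩

lemma notMem_star_of_adj {x y : X} (hxS : x ∉ star H D) (hx : ¬ 3 ≤ (H.neighborSet x).encard)
    (hxy : H.Adj x y) (hD : ∀ x ∈ D, 3 ≤ (H.neighborSet x).encard) : y ∉ star H D := by
  rintro (hy | ⟨hy, z, v, hl, hv⟩)
  · exact hxS (Or.inr ⟨hx, y, y, Leads.branch hxy (hD y hy), hy⟩)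
  · by_cases hzx : z = x
    · subst hzx
      cases hl with
      | branch => exact hx (hD z hv)
      | step _ _ _ _ hl => exact hxS (Or.inr ⟨hx, _, v, hl, hv⟩)
    · exact hxS (Or.inr ⟨hx, y, v, Leads.step hxy hy hl.adj hzx hl, hv⟩)

lemma exists_leads_of_adj_of_mem_star {x y : X} (hxS : x ∉ star H D)
    (hx : 3 ≤ (H.neighborSet x).encard) (hxy : H.Adj x y)
    (hD : ∀ x ∈ D, 3 ≤ (H.neighborSet x).encard) (hy : y ∈ star H D) :
    ∃ v ∈ D, Leads H x y v := by
  rcases hy with hy | ⟨hy, z, v, hl, hv⟩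
  · exact ⟨y, hy, Leads.branch hxy (hD y hy)⟩
  · by_cases hzx : z = x
    · subst hzx
      cases hl with
      | branch => exact absurd (Or.inl hv) hxS
      | step _ h => exact absurd hx h
    · exact ⟨v, hv, Leads.step hxy hy hl.adj hzx hl⟩

lemma neighborSet_within {S : Set X} {x : X} (hx : x ∈ S) :
    (within H S).neighborSet x = H.neighborSet x ∩ S := by
  ext y
  exact ⟨fun h => ⟨h.1, h.2.2⟩, fun h => ⟨h.1, hx, h.2⟩⟩

lemma Leads.exists_leads_within (hg : Good H A) (hD : ∀ x ∈ D, 3 ≤ (H.neighborSet x).encard)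
    {x y u : X} (h : Leads H x y u) (hx : x ∈ A \ star H D) (hy : y ∈ A \ star H D)
    (hu : ∀ t, (within H (A \ star H D)).Adj t u → ∃ w, Leads (within H (A \ star H D)) t u w) :
    ∃ w, Leads (within H (A \ star H D)) x y w := by
  induction h with
  | branch hxy => exact hu _ ⟨hxy, hx, hy⟩
  | @step x y z u hxy h3 hyz hzx _ ih =>
    have hz : z ∈ A \ star H D :=
      ⟨hg.mem _ _ hyz.symm, notMem_star_of_adj hy.2 h3 hyz hD⟩
    obtain ⟨w, hw⟩ := ih hy hz hu
    refine ⟨w, Leads.step ⟨hxy, hx, hy⟩ (fun h => h3 (h.trans ?_)) ⟨hyz, hy, hz⟩ hzx hw⟩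
    exact Set.encard_le_encard fun v hv => hv.1

/-- Deleting the star of a separated set keeps the graph good. -/
lemma Good.sdiff_star (hg : Good H A) (hD : Separated H hH D) :
    Good (within H (A \ star H D)) (A \ star H D) := by
  have hD3 := hD.three_le
  have hN : ∀ x ∈ A \ star H D, (∀ y, H.Adj x y → y ∉ star H D) →
      (within H (A \ star H D)).neighborSet x = H.neighborSet x := by
    intro x hx h
    rw [neighborSet_within hx, Set.inter_eq_left]
    exact fun y hy => ⟨hg.mem _ _ (H.adj_symm hy), h y hy⟩
  have hdef : ∀ x ∈ A \ star H D, 3 ≤ (H.neighborSet x).encard →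
      ¬ 3 ≤ ((within H (A \ star H D)).neighborSet x).encard → ∃ v ∈ D, ∃ y, Leads H x y v := by
    intro x hx h3 h3'
    by_contra! hcon
    refine h3' ?_
    rw [hN x hx]
    · exact h3
    · intro y hxy hy
      obtain ⟨v, hv, hl⟩ := exists_leads_of_adj_of_mem_star hx.2 h3 hxy hD3 hy
      exact hcon v hv y hl
  have htwo : ∀ x ∈ A \ star H D, 2 ≤ ((within H (A \ star H D)).neighborSet x).encard := by
    intro x hx
    by_cases h3 : 3 ≤ (H.neighborSet x).encard
    · by_cases hall : ∀ y, H.Adj x y → y ∉ star H D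
      · rw [hN x hx hall]
        exact hg.two_le x hx.1
      · push Not at hall
        obtain ⟨y, hxy, hy⟩ := hall
        obtain ⟨v, hv, hl⟩ := exists_leads_of_adj_of_mem_star hx.2 h3 hxy hD3 hy
        have hsub : H.neighborSet x \ {y} ⊆ (within H (A \ star H D)).neighborSet x := by
          rintro z ⟨hxz, hzy⟩
          refine ⟨hxz, hx, hg.mem _ _ (H.adj_symm hxz), fun hz => hzy ?_⟩
          obtain ⟨v', hv', hl'⟩ := exists_leads_of_adj_of_mem_star hx.2 h3 hxz hD3 hz
          obtain rfl := hD.eq_of_linked hv hv' ⟨h3, y, hl⟩ ⟨h3, z, hl'⟩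
          exact hl'.eq_of_leads hH h3 hl
        refine le_trans ?_ (Set.encard_le_encard hsub)
        have h1 := Set.encard_sdiff_singleton_add_one (show y ∈ H.neighborSet x from hxy)
        rw [← h1] at h3
        exact (ENat.add_le_add_iff_right ENat.one_ne_top).1 ((by norm_num : (2 : ℕ∞) + 1 = 3) ▸ h3)
    · rw [hN x hx fun y hxy => notMem_star_of_adj hx.2 h3 hxy hD3]
      exact hg.two_le x hx.1
  refine ⟨fun x y h => h.2.1, htwo, fun x y hxy => ?_⟩
  obtain ⟨u, hu⟩ := hg.exists_leads x y hxy.1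
  refine hu.exists_leads_within hg hD3 hxy.2.1 hxy.2.2 fun t htu => ?_
  by_cases h3 : 3 ≤ ((within H (A \ star H D)).neighborSet u).encard
  · exact ⟨u, Leads.branch htu h3⟩
  have huB := htu.2.2
  obtain ⟨v, hv, r, hr⟩ := hdef u huB hu.three_le h3
  have h1 : 1 < ((within H (A \ star H D)).neighborSet u).encard :=
    lt_of_lt_of_le (by norm_num) (htwo u huB)
  obtain ⟨s, hus, hst⟩ := (Set.one_lt_encard_iff_nontrivial.1 h1).exists_ne t
  obtain ⟨u', hu'⟩ := hg.exists_leads u s hus.1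
  obtain ⟨w, hw⟩ := hu'.exists_leads_within hg hD3 huB hus.2.2 fun t' ht' => by
    refine ⟨u', Leads.branch ht' ?_⟩
    by_contra h3'
    obtain ⟨v', hv', r', hr'⟩ := hdef u' ht'.2.2 hu'.three_le h3'
    by_cases hvv : v = v'
    · subst hvv
      exact Leads.not_triangle hH hu.three_le hu' hr hr'
    · exact hD.not_adj v hv v' hv' ⟨hvv, u, u',
        Or.inr (Linked.symm hH ⟨hu.three_le, r, hr⟩), Or.inr ⟨hu.three_le, s, hu'⟩,
        Or.inr ⟨hu'.three_le, r', hr'⟩⟩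
  exact ⟨w, Leads.step htu h3 hus hst hw⟩

/-- The stars of the classes of a coloring cover. -/
lemma Good.exists_mem_star (hg : Good H A) {κ : Type*} (c : X → κ) {x : X} (hx : x ∈ A) :
    ∃ j, x ∈ star H {v | 3 ≤ (H.neighborSet v).encard ∧ c v = j} := by
  by_cases h3 : 3 ≤ (H.neighborSet x).encard
  · exact ⟨c x, Or.inl ⟨h3, rfl⟩⟩
  · obtain ⟨y, hy⟩ := hg.exists_adj hx
    obtain ⟨v, hv⟩ := hg.exists_leads x y hy
    exact ⟨c v, Or.inr ⟨h3, y, v, hv, hv.three_le, rfl⟩⟩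

lemma separated_of_coloring {κ : Type*} {c : X → κ}
    (hc : ∀ x y, (conflict H hH).Adj x y → c x ≠ c y) (j : κ) :
    Separated H hH {v | 3 ≤ (H.neighborSet v).encard ∧ c v = j} :=
  ⟨fun _ h => h.1, fun x hx y hy h => hc x y h (hx.2.trans hy.2.symm)⟩

end Star

section Step

variable {X : Type*} {G H : SimpleGraph X}

lemma three_le_encard_iff {S : Set X} : 3 ≤ S.encard ↔
    ∃ a ∈ S, ∃ b ∈ S, ∃ c ∈ S, a ≠ b ∧ a ≠ c ∧ b ≠ c := by
  constructor
  · intro h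
    obtain ⟨T, hTS, hT⟩ := Set.exists_subset_encard_eq h
    obtain ⟨a, b, c, hab, hac, hbc, rfl⟩ := Set.encard_eq_three.1 hT
    exact ⟨a, hTS (by simp), b, hTS (by simp), c, hTS (by simp), hab, hac, hbc⟩
  · rintro ⟨a, ha, b, hb, c, hc, hab, hac, hbc⟩
    exact three_le_encard_of_ne ha hb hc hab hac hbc

lemma Leads.reachable_of_le {x y v : X} (hHG : H ≤ G) (h : Leads H x y v) : G.Reachable y v := by
  induction h with
  | branch => exact SimpleGraph.Reachable.refl _
  | step _ _ hyz _ _ ih => exact (hHG hyz).reachable.trans ih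

lemma Linked.reachable {u v : X} (hHG : H ≤ G) (h : Linked H u v) : G.Reachable u v := by
  obtain ⟨-, y, hy⟩ := h
  exact (hHG hy.adj).reachable.trans (hy.reachable_of_le hHG)

lemma good_of_exists_three_le {A : Set X} (hmem : ∀ x y, H.Adj x y → x ∈ A)
    (h2 : ∀ x ∈ A, 2 ≤ (H.neighborSet x).encard)
    (h3 : ∀ x ∈ A, ¬ 3 ≤ (H.neighborSet x).encard →
      ∃ y, H.Adj x y ∧ 3 ≤ (H.neighborSet y).encard) : Good H A := by
  refine ⟨hmem, h2, fun x y hxy => ?_⟩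
  have hnext : ∀ x y, H.Adj x y → ∃ z, H.Adj y z ∧ z ≠ x := by
    intro x y hxy
    have h1 : 1 < (H.neighborSet y).encard :=
      lt_of_lt_of_le (by norm_num) (h2 y (hmem _ _ hxy.symm))
    exact (Set.one_lt_encard_iff_nontrivial.1 h1).exists_ne x
  by_cases hy : 3 ≤ (H.neighborSet y).encard
  · exact ⟨y, Leads.branch hxy hy⟩
  obtain ⟨z, hyz, hzx⟩ := hnext x y hxy
  by_cases hz : 3 ≤ (H.neighborSet z).encard
  · exact ⟨z, Leads.step hxy hy hyz hzx (Leads.branch hyz hz)⟩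
  obtain ⟨w, hzw, hwy⟩ := hnext y z hyz
  obtain ⟨w', hzw', hw'⟩ := h3 z (hmem _ _ hzw) hz
  have hw'y : w' ≠ y := by rintro rfl; exact hy hw'
  obtain rfl := eq_of_not_three_le hz hyz hzw hzw' hwy hw'y
  exact ⟨w, Leads.step hxy hy hyz hzx (Leads.step hyz hz hzw hwy (Leads.branch hzw hw'))⟩

variable [MeasurableSpace X] [StandardBorelSpace X] {Φ : ℕ → X → X}

lemma measurableSet_three_le (hΦ : OrbitEnum G Φ) (hHG : H ≤ G)
    (hHm : MeasurableSet {p : X × X | H.Adj p.1 p.2}) :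
    MeasurableSet {x | 3 ≤ (H.neighborSet x).encard} := by
  have hadj : ∀ {Z : Type _} [MeasurableSpace Z] {f g : Z → X}, Measurable f → Measurable g →
      MeasurableSet {z | H.Adj (f z) (g z)} := fun hf hg => (hf.prodMk hg) hHm
  have h3 : MeasurableSet {p : ((X × X) × X) × X | H.Adj p.1.1.1 p.2 ∧ p.1.1.2 ≠ p.1.2 ∧
      p.1.1.2 ≠ p.2 ∧ p.1.2 ≠ p.2} := by
    have hm1 : Measurable fun p : ((X × X) × X) × X => p.1.1.1 := by fun_prop
    have hm2 : Measurable fun p : ((X × X) × X) × X => p.1.1.2 := by fun_prop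
    have hm3 : Measurable fun p : ((X × X) × X) × X => p.1.2 := by fun_prop
    have hm4 : Measurable fun p : ((X × X) × X) × X => p.2 := by fun_prop
    exact (hadj hm1 hm4).inter ((measurableSet_eq_fun hm2 hm3).compl.inter
      ((measurableSet_eq_fun hm2 hm4).compl.inter (measurableSet_eq_fun hm3 hm4).compl))
  have h2 : MeasurableSet {p : (X × X) × X | H.Adj p.1.1 p.2 ∧ ∃ c, H.Adj p.1.1 c ∧ p.1.2 ≠ p.2 ∧
      p.1.2 ≠ c ∧ p.2 ≠ c} := by
    refine (hadj (by fun_prop) (by fun_prop)).inter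
      (hΦ.measurableSet_exists (g := fun p : (X × X) × X => p.1.1) (by fun_prop) h3 ?_)
    exact fun z y h => (hHG h.1).reachable
  have h1 : MeasurableSet {p : X × X | H.Adj p.1 p.2 ∧ ∃ b, H.Adj p.1 b ∧ ∃ c, H.Adj p.1 c ∧
      p.2 ≠ b ∧ p.2 ≠ c ∧ b ≠ c} := by
    refine hHm.inter (hΦ.measurableSet_exists (g := fun p : X × X => p.1) (by fun_prop) h2 ?_)
    exact fun z y h => (hHG h.1).reachable
  have h0 := hΦ.measurableSet_exists measurable_id (P := fun x a => H.Adj x a ∧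
    ∃ b, H.Adj x b ∧ ∃ c, H.Adj x c ∧ a ≠ b ∧ a ≠ c ∧ b ≠ c) h1 fun z y h => (hHG h.1).reachable
  convert h0 using 1
  ext x
  exact three_le_encard_iff

lemma measurableSet_leads (hΦ : OrbitEnum G Φ) (hHG : H ≤ G)
    (hHm : MeasurableSet {p : X × X | H.Adj p.1 p.2}) :
    MeasurableSet {p : X × X × X | Leads H p.1 p.2.1 p.2.2} := by
  have h3 := measurableSet_three_le hΦ hHG hHm
  obtain ⟨L, hL0, hLs⟩ : ∃ L : ℕ → X → X → X → Prop,
      (L 0 = fun x y v => H.Adj x y ∧ y = v ∧ 3 ≤ (H.neighborSet y).encard) ∧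
      ∀ n, L (n + 1) = fun x y v => H.Adj x y ∧ ¬ 3 ≤ (H.neighborSet y).encard ∧
        ∃ z, H.Adj y z ∧ z ≠ x ∧ L n y z v :=
    ⟨fun n => n.rec (fun x y v => H.Adj x y ∧ y = v ∧ 3 ≤ (H.neighborSet y).encard)
      fun _ S x y v => H.Adj x y ∧ ¬ 3 ≤ (H.neighborSet y).encard ∧ ∃ z, H.Adj y z ∧ z ≠ x ∧
        S y z v, rfl, fun _ => rfl⟩
  have hL : ∀ n, MeasurableSet {p : X × X × X | L n p.1 p.2.1 p.2.2} := by
    have m1 : Measurable fun p : X × X × X => p.1 := by fun_prop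
    have m2 : Measurable fun p : X × X × X => p.2.1 := by fun_prop
    have m3 : Measurable fun p : X × X × X => p.2.2 := by fun_prop
    intro n
    induction n with
    | zero =>
      rw [hL0]
      exact ((m1.prodMk m2) hHm).inter ((measurableSet_eq_fun m2 m3).inter (m2 h3))
    | succ n ih =>
      rw [hLs]
      refine ((m1.prodMk m2) hHm).inter ((m2 h3).compl.inter
        (hΦ.measurableSet_exists m2 (P := fun p z => H.Adj p.2.1 z ∧ z ≠ p.1 ∧
          L n p.2.1 z p.2.2) ?_ fun p z h => (hHG h.1).reachable))
      have n1 : Measurable fun q : (X × X × X) × X => q.1.1 := by fun_prop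
      have n2 : Measurable fun q : (X × X × X) × X => q.1.2.1 := by fun_prop
      have n3 : Measurable fun q : (X × X × X) × X => q.1.2.2 := by fun_prop
      have n4 : Measurable fun q : (X × X × X) × X => q.2 := by fun_prop
      exact ((n2.prodMk n4) hHm).inter ((measurableSet_eq_fun n4 n1).compl.inter
        ((n2.prodMk (n4.prodMk n3)) ih))
  convert MeasurableSet.iUnion hL using 1
  ext ⟨x, y, v⟩
  rw [Set.mem_iUnion]
  change Leads H x y v ↔ ∃ n, L n x y v
  constructor
  · intro h
    induction h with
    | branch hxy h3 => exact ⟨0, by rw [hL0]; exact ⟨hxy, rfl, h3⟩⟩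
    | step hxy h3 hyz hzx _ ih =>
      obtain ⟨n, hn⟩ := ih
      exact ⟨n + 1, by rw [hLs]; exact ⟨hxy, h3, _, hyz, hzx, hn⟩⟩
  · rintro ⟨n, hn⟩
    induction n generalizing x y with
    | zero =>
      rw [hL0] at hn
      obtain ⟨hxy, rfl, h3⟩ := hn
      exact Leads.branch hxy h3
    | succ n ih =>
      rw [hLs] at hn
      obtain ⟨hxy, h3, z, hyz, hzx, hn⟩ := hn
      exact Leads.step hxy h3 hyz hzx (ih y z hn)

lemma measurableSet_linked (hΦ : OrbitEnum G Φ) (hHG : H ≤ G)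
    (hHm : MeasurableSet {p : X × X | H.Adj p.1 p.2}) :
    MeasurableSet {p : X × X | Linked H p.1 p.2} := by
  refine (measurable_fst (measurableSet_three_le hΦ hHG hHm)).inter
    (hΦ.measurableSet_exists measurable_fst (P := fun p y => Leads H p.1 y p.2) ?_
      fun p y h => (hHG h.adj).reachable)
  have m : Measurable fun q : (X × X) × X => (q.1.1, q.2, q.1.2) := by fun_prop
  exact m (measurableSet_leads hΦ hHG hHm)

lemma measurableSet_conflict (hΦ : OrbitEnum G Φ) (hHG : H ≤ G)
    (hHm : MeasurableSet {p : X × X | H.Adj p.1 p.2}) (hH : H.IsAcyclic) :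
    MeasurableSet {p : X × X | (conflict H hH).Adj p.1 p.2} := by
  have hl : MeasurableSet {p : X × X | p.1 = p.2 ∨ Linked H p.1 p.2} :=
    (measurableSet_eq_fun measurable_fst measurable_snd).union (measurableSet_linked hΦ hHG hHm)
  have hr : ∀ a b, (a = b ∨ Linked H a b) → G.Reachable a b := by
    rintro a b (rfl | h)
    · exact SimpleGraph.Reachable.refl _
    · exact h.reachable hHG
  refine (measurableSet_eq_fun measurable_fst measurable_snd).compl.inter
    (hΦ.measurableSet_exists measurable_fst (P := fun p a => ∃ b, (p.1 = a ∨ Linked H p.1 a) ∧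
      (a = b ∨ Linked H a b) ∧ (b = p.2 ∨ Linked H b p.2)) ?_ ?_)
  · refine hΦ.measurableSet_exists (Z := (X × X) × X) measurable_snd (P := fun q b =>
      (q.1.1 = q.2 ∨ Linked H q.1.1 q.2) ∧ (q.2 = b ∨ Linked H q.2 b) ∧
        (b = q.1.2 ∨ Linked H b q.1.2)) ?_ fun q b h => hr _ _ h.2.1
    have n1 : Measurable fun q : ((X × X) × X) × X => (q.1.1.1, q.1.2) := by fun_prop
    have n2 : Measurable fun q : ((X × X) × X) × X => (q.1.2, q.2) := by fun_prop
    have n3 : Measurable fun q : ((X × X) × X) × X => (q.2, q.1.1.2) := by fun_prop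
    exact (n1 hl).inter ((n2 hl).inter (n3 hl))
  · rintro p a ⟨b, h, -⟩
    exact hr _ _ h

lemma measurableSet_star (hΦ : OrbitEnum G Φ) (hHG : H ≤ G)
    (hHm : MeasurableSet {p : X × X | H.Adj p.1 p.2}) {D : Set X} (hD : MeasurableSet D) :
    MeasurableSet (star H D) := by
  refine hD.union ((measurableSet_three_le hΦ hHG hHm).compl.inter
    (hΦ.measurableSet_exists measurable_id (P := fun x y => ∃ v, Leads H x y v ∧ v ∈ D) ?_ ?_))
  · refine hΦ.measurableSet_exists (Z := X × X) measurable_snd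
      (P := fun p v => Leads H p.1 p.2 v ∧ v ∈ D) ?_ fun p v h => h.1.reachable_of_le hHG
    have m : Measurable fun q : (X × X) × X => (q.1.1, q.1.2, q.2) := by fun_prop
    exact (m (measurableSet_leads hΦ hHG hHm)).inter (measurable_snd hD)
  · rintro x y ⟨v, h, -⟩
    exact (hHG h.adj).reachable

/-- One step of the construction: a fixed proportion of a good set can be deleted, keeping it good.
-/
lemma Good.exists_step (hΦ : OrbitEnum G Φ) (hHG : H ≤ G)
    (hHm : MeasurableSet {p : X × X | H.Adj p.1 p.2}) (hH : H.IsAcyclic) {d : ℕ}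
    (hdeg : ∀ x, (H.neighborSet x).encard ≤ (d : ℕ∞)) {A : Set X} (hA : MeasurableSet A)
    (hg : Good H A) (ν : Measure X) [IsFiniteMeasure ν] :
    ∃ B ⊆ A, MeasurableSet B ∧ Good (within H B) B ∧ (∀ x ∈ A, ∃ b ∈ B, H.Reachable x b) ∧
      ((d + 1) ^ 3 + 1 : ℕ) * ν.real B ≤ ((d + 1) ^ 3 : ℕ) * ν.real A := by
  have : NeZero ((d + 1) ^ 3 + 1) := ⟨by omega⟩
  obtain ⟨c, hc, hcp⟩ := exists_measurable_coloring_of_degree_lt hΦ (conflict H hH)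
    (measurableSet_conflict hΦ hHG hHm hH) (fun x y h => by
      obtain ⟨-, a, b, h1, h2, h3⟩ := h
      have hr : ∀ a b, (a = b ∨ Linked H a b) → G.Reachable a b := by
        rintro a b (rfl | h)
        · exact SimpleGraph.Reachable.refl _
        · exact h.reachable hHG
      exact (hr _ _ h1).trans ((hr _ _ h2).trans (hr _ _ h3)))
    ((d + 1) ^ 3 + 1) (encard_conflict_lt hH hdeg)
  generalize hK : (d + 1) ^ 3 = K at c hc hcp
  let D : Fin (K + 1) → Set X := fun j => {v | 3 ≤ (H.neighborSet v).encard ∧ c v = j}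
  have hD : ∀ j, MeasurableSet (D j) := fun j =>
    (measurableSet_three_le hΦ hHG hHm).inter (hc (measurableSet_singleton j))
  have hS : ∀ j, MeasurableSet (star H (D j)) := fun j => measurableSet_star hΦ hHG hHm (hD j)
  obtain ⟨j, hj⟩ : ∃ j, ν.real A ≤ (K + 1 : ℕ) * ν.real (A ∩ star H (D j)) := by
    by_contra! hcon
    have h1 : ν.real A ≤ ∑ j, ν.real (A ∩ star H (D j)) := by
      refine (measureReal_mono ?_).trans (measureReal_iUnion_fintype_le _)
      intro x hx
      obtain ⟨j, hj⟩ := hg.exists_mem_star c hx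
      exact Set.mem_iUnion.2 ⟨j, hx, hj⟩
    have h2 : ∑ j : Fin (K + 1), (K + 1 : ℕ) * ν.real (A ∩ star H (D j)) <
        ∑ j : Fin (K + 1), ν.real A :=
      Finset.sum_lt_sum_of_nonempty Finset.univ_nonempty fun j _ => hcon j
    rw [← Finset.mul_sum, Finset.sum_const, Finset.card_univ, Fintype.card_fin, nsmul_eq_mul] at h2
    have h3 : (0 : ℝ) < (K + 1 : ℕ) := by positivity
    exact (lt_of_mul_lt_mul_left h2 h3.le).not_ge h1
  have hsep : Separated H hH (D j) := separated_of_coloring hcp j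
  refine ⟨A \ star H (D j), Set.sdiff_subset, hA.diff (hS j), hg.sdiff_star hsep,
    fun x hx => hg.exists_reachable_sdiff_star hsep hx, ?_⟩
  have h1 := measureReal_inter_add_sdiff (μ := ν) (s := A) (hS j)
  push_cast at hj ⊢
  nlinarith

end Step

section Exhaustion

variable {X : Type*} {G T : SimpleGraph X} {d : ℕ}

lemma within_within {A B : Set X} (h : B ⊆ A) : within (within T A) B = within T B := by
  ext x y
  exact ⟨fun h' => ⟨h'.1.1, h'.2⟩, fun h' => ⟨⟨h'.1, h h'.2.1, h h'.2.2⟩, h'.2⟩⟩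

lemma Hard.good_msf {U : Set X} (hU : Hard G d U) (hd : 3 ≤ d)
    (hdeg : ∀ x, (G.neighborSet x).encard ≤ (d : ℕ∞)) (hclique : G.CliqueFree (d + 1))
    (e : X → ℝ) : Good (within (msf G e) U) U := by
  have hN : ∀ x ∈ U, (within (msf G e) U).neighborSet x = (msf G e).neighborSet x := by
    intro x hx
    rw [neighborSet_within hx, Set.inter_eq_left]
    exact fun y hy => hU.mem_of_reachable x hx y (msf_le G e hy).reachable
  refine good_of_exists_three_le (fun x y h => h.2.1) (fun x hx => ?_) (fun x hx h3 => ?_)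
  · obtain ⟨y, z, hy, hz, hyz⟩ := hU.exists_two_msf_adj hd hdeg hclique e hx
    rw [hN x hx, ← Set.encard_pair (x := y) (y := z)
      (by rintro rfl; exact hyz (SimpleGraph.Reachable.refl _))]
    exact Set.encard_le_encard (by rintro w (rfl | rfl) <;> assumption)
  · rw [hN x hx] at h3
    obtain ⟨y, hxy, hy⟩ := hU.exists_msf_adj_three_le hd hdeg hclique e hx h3
    have hyU := hU.mem_of_reachable x hx y (msf_le G e hxy).reachable
    exact ⟨y, ⟨hxy, hx, hyU⟩, by rwa [hN y hyU]⟩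

variable [MeasurableSpace X] {Φ : ℕ → X → X}

lemma measurableSet_within (hT : MeasurableSet {p : X × X | T.Adj p.1 p.2}) {A : Set X}
    (hA : MeasurableSet A) : MeasurableSet {p : X × X | (within T A).Adj p.1 p.2} :=
  hT.inter ((measurable_fst hA).inter (measurable_snd hA))

/-- The Borel rank function of a decreasing sequence of sets, each of which is connected to the
next one. -/
lemma exists_measurable_rank_of_antitone (hΦ : OrbitEnum G Φ) (hTG : T ≤ G)
    (hTm : MeasurableSet {p : X × X | T.Adj p.1 p.2})
    (hdeg : ∀ x, (G.neighborSet x).encard ≤ (d : ℕ∞)) {A : ℕ → Set X}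
    (hA : ∀ n, MeasurableSet (A n)) (hanti : Antitone A)
    (hr : ∀ n, ∀ x ∈ A n, ∃ b ∈ A (n + 1), (within T (A n)).Reachable x b) :
    ∃ ρ : X → ℕ ×ₗ (ℕ ×ₗ ℕ), (∀ p, MeasurableSet {x | ρ x = p}) ∧
      ∀ x ∈ A 0, (∀ y, G.Reachable x y → y ∉ ⋂ n, A n) → ∃ y, G.Adj x y ∧ ρ x < ρ y := by
  have hle := fun n => (within_le T (A n)).trans hTG
  have hrank := fun n => exists_measurable_rank hΦ (within T (A n))
    (measurableSet_within hTm (hA n)) (fun x y h => (hle n h).reachable)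
    (fun x => Set.finite_of_encard_le_coe
      ((Set.encard_le_encard fun y hy => hle n hy).trans (hdeg x))) (hA (n + 1))
  choose ρ hρm hρ using hrank
  have hlev : ∀ {x}, x ∈ A 0 → x ∉ ⋂ n, A n → ∃ n, x ∈ A n ∧ x ∉ A (n + 1) := by
    intro x hx0 hx
    by_contra! hcon
    refine hx (Set.mem_iInter.2 fun n => ?_)
    induction n with
    | zero => exact hx0
    | succ n ih => exact hcon n ih
  obtain ⟨l, hlm, hl⟩ := exists_measurable_piecewise (fun n => A n \ A (n + 1))
    (fun n => (hA n).diff (hA (n + 1))) (fun n _ => n) (fun n => measurable_const)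
    (fun i j hij x hx => by
      rcases hij.lt_or_gt with h | h
      · exact absurd (hanti h hx.2.1) hx.1.2
      · exact absurd (hanti h hx.1.1) hx.2.2)
  refine ⟨fun x => toLex (l x, ρ (l x) x), fun p => ?_, fun x hx0 hx => ?_⟩
  · have : {x | toLex (l x, ρ (l x) x) = p} =
        l ⁻¹' {(ofLex p).1} ∩ {x | ρ (ofLex p).1 x = (ofLex p).2} := by
      ext x
      constructor
      · rintro rfl
        exact ⟨rfl, rfl⟩
      · rintro ⟨h1, h2⟩
        refine congrArg toLex (Prod.ext h1 ?_)
        exact (congrArg (fun n => ρ n x) (show l x = _ from h1)).trans h2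
    rw [this]
    exact (hlm (measurableSet_singleton _)).inter (hρm _ _)
  · obtain ⟨n, hn, hn'⟩ := hlev hx0 (hx x (SimpleGraph.Reachable.refl _))
    obtain ⟨y, hxy, hlt⟩ := hρ n x hn' (hr n x hn)
    have hyG := hle n hxy
    obtain ⟨m, hm, hm'⟩ := hlev (hanti n.zero_le hxy.2.2) (hx y hyG.reachable)
    have hnm : n ≤ m := by
      by_contra! h
      exact hm' (hanti h hxy.2.2)
    have hlx : l x = n := hl n ⟨hn, hn'⟩
    have hly : l y = m := hl m ⟨hm, hm'⟩
    refine ⟨y, hyG, Prod.Lex.toLex_lt_toLex.2 ?_⟩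
    simp only [hlx, hly]
    rcases hnm.lt_or_eq with h | rfl
    · exact Or.inl h
    · exact Or.inr ⟨rfl, hlt⟩

variable [StandardBorelSpace X]

/-- A good set contains a decreasing sequence of sets whose intersection is null, each of which
is connected to the next one. -/
lemma Good.exists_seq (hΦ : OrbitEnum G Φ) (hTG : T ≤ G)
    (hTm : MeasurableSet {p : X × X | T.Adj p.1 p.2}) (hT : T.IsAcyclic)
    (hdeg : ∀ x, (G.neighborSet x).encard ≤ (d : ℕ∞)) {U : Set X} (hU : MeasurableSet U)
    (hg : Good (within T U) U) (ν : Measure X) [IsFiniteMeasure ν] :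
    ∃ A : ℕ → Set X, A 0 = U ∧ (∀ n, MeasurableSet (A n)) ∧ Antitone A ∧
      (∀ n, ∀ x ∈ A n, ∃ b ∈ A (n + 1), (within T (A n)).Reachable x b) ∧
      ν (⋂ n, A n) = 0 := by
  have hstep : ∀ A : {A : Set X // MeasurableSet A ∧ Good (within T A) A},
      ∃ B : {A : Set X // MeasurableSet A ∧ Good (within T A) A}, B.1 ⊆ A.1 ∧
        (∀ x ∈ A.1, ∃ b ∈ B.1, (within T A.1).Reachable x b) ∧
        ((d + 1) ^ 3 + 1 : ℕ) * ν.real B.1 ≤ ((d + 1) ^ 3 : ℕ) * ν.real A.1 := by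
    rintro ⟨A, hA, hgA⟩
    have hle := (within_le T A).trans hTG
    obtain ⟨B, hBA, hB, hgB, hr, hν⟩ := Good.exists_step hΦ hle (measurableSet_within hTm hA)
      (hT.anti (within_le T A))
      (fun x => (Set.encard_le_encard fun y hy => hle hy).trans (hdeg x)) hA hgA ν
    rw [within_within hBA] at hgB
    exact ⟨⟨B, hB, hgB⟩, hBA, hr, hν⟩
  choose F hFsub hFr hFν using hstep
  obtain ⟨S, hS0, hSs⟩ : ∃ S : ℕ → {A : Set X // MeasurableSet A ∧ Good (within T A) A},
      S 0 = ⟨U, hU, hg⟩ ∧ ∀ n, S (n + 1) = F (S n) :=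
    ⟨fun n => n.rec ⟨U, hU, hg⟩ fun _ A => F A, rfl, fun _ => rfl⟩
  refine ⟨fun n => (S n).1, congrArg Subtype.val hS0, fun n => (S n).2.1,
    antitone_nat_of_succ_le fun n => ?_, fun n x hx => ?_, ?_⟩
  · rw [hSs]
    exact hFsub _
  · change ∃ b ∈ (S (n + 1)).1, _
    rw [hSs]
    exact hFr _ x hx
  · generalize (d + 1) ^ 3 = K at hFν
    have hK : (0 : ℝ) < K + 1 := by positivity
    have hle : ∀ n, ν.real (⋂ n, (S n).1) ≤ (K / (K + 1) : ℝ) ^ n * ν.real U := by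
      intro n
      refine (measureReal_mono (Set.iInter_subset _ n)).trans ?_
      induction n with
      | zero => rw [hS0, pow_zero, one_mul]
      | succ n ih =>
        have h1 := hFν (S n)
        rw [← hSs] at h1
        push_cast at h1
        calc ν.real (S (n + 1)).1 ≤ (K / (K + 1) : ℝ) * ν.real (S n).1 := by
              rw [div_mul_eq_mul_div, le_div_iff₀ hK]
              linarith
          _ ≤ (K / (K + 1) : ℝ) * ((K / (K + 1) : ℝ) ^ n * ν.real U) := by gcongr
          _ = _ := by ring
    have hlim : Filter.Tendsto (fun n : ℕ => (K / (K + 1) : ℝ) ^ n * ν.real U) Filter.atTop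
        (nhds (0 * ν.real U)) :=
      (tendsto_pow_atTop_nhds_zero_of_lt_one (by positivity)
        ((div_lt_one hK).2 (lt_add_one _))).mul_const _
    rw [zero_mul] at hlim
    have h0 := ge_of_tendsto' hlim hle
    exact (measureReal_eq_zero_iff).1 (le_antisymm h0 measureReal_nonneg)

/-- On a hard set, there is a Borel coloring which is proper off an invariant null set. -/
lemma Hard.exists_measurable_coloring (hΦ : OrbitEnum G Φ)
    (hG : MeasurableSet {p : X × X | G.Adj p.1 p.2}) (hd : 3 ≤ d)
    (hdeg : ∀ x, (G.neighborSet x).encard ≤ (d : ℕ∞)) (hclique : G.CliqueFree (d + 1))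
    {U : Set X} (hU : Hard G d U) (hUm : MeasurableSet U) (μ : Measure X) [IsFiniteMeasure μ] :
    ∃ M : Set X, μ M = 0 ∧ (∀ x y, G.Adj x y → x ∈ M → y ∈ M) ∧ ∃ c : X → Fin d,
      Measurable c ∧ ∀ x y, G.Adj x y → x ∈ U → x ∉ M → c x ≠ c y := by
  obtain ⟨e, he⟩ := exists_measurableEmbedding_real X
  let ν := (Measure.sum fun k => μ.map (Φ k)).toFinite
  have hTm := measurableSet_msf_adj hΦ hG he.measurable
  obtain ⟨A, hA0, hA, hanti, hr, hν⟩ := (hU.good_msf hd hdeg hclique e).exists_seq hΦ (msf_le G e)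
    hTm (msf_isAcyclic he.injective) hdeg hUm ν
  obtain ⟨ρ, hρm, hρ⟩ := exists_measurable_rank_of_antitone hΦ (msf_le G e) hTm hdeg hA hanti hr
  obtain ⟨c, hcm, hc⟩ := exists_measurable_coloring_of_rank hΦ hG (by omega) hdeg ρ hρm
  have hinv : ∀ x y, G.Adj x y → (∃ z ∈ ⋂ n, A n, G.Reachable x z) →
      ∃ z ∈ ⋂ n, A n, G.Reachable y z :=
    fun x y hxy ⟨z, hz, hxz⟩ => ⟨z, hz, hxy.symm.reachable.trans hxz⟩
  refine ⟨{x | ∃ z ∈ ⋂ n, A n, G.Reachable x z}, ?_, hinv, c, hcm, fun x y hxy hx hxM => ?_⟩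
  · have h0 := absolutelyContinuous_toFinite (Measure.sum fun k => μ.map (Φ k)) hν
    rw [Measure.sum_apply_eq_zero] at h0
    refine measure_mono_null (t := ⋃ k, Φ k ⁻¹' ⋂ n, A n) ?_ (measure_iUnion_null fun k => ?_)
    · rintro x ⟨z, hz, hxz⟩
      obtain ⟨k, rfl⟩ := (hΦ.reach x z).1 hxz
      exact Set.mem_iUnion.2 ⟨k, hz⟩
    · rw [← Measure.map_apply (hΦ.meas k) (MeasurableSet.iInter hA)]
      exact h0 k
  · refine hc x y hxy (hρ x (hA0 ▸ hx) fun z hxz hz => hxM ⟨z, hz, hxz⟩)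
      (hρ y (hA0 ▸ hU.mem_of_reachable x hx y hxy.reachable) fun z hyz hz =>
        hxM (hinv y x hxy.symm ⟨z, hz, hyz⟩))

end Exhaustion

end MeasurableBrooks

open MeasurableBrooks

theorem stmt_0 {X : Type*} [MeasurableSpace X] [StandardBorelSpace X]
    (G : SimpleGraph X) (hGmeas : MeasurableSet {p : X × X | G.Adj p.1 p.2})
    (d : ℕ) (hd : 3 ≤ d)
    (hdeg : ∀ x : X, (G.neighborSet x).encard ≤ (d : ℕ∞))
    (hclique : G.CliqueFree (d + 1))
    (μ : Measure X) [IsProbabilityMeasure μ] :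
    ∃ c : X → Fin d, NullMeasurable c μ ∧ ∀ x y : X, G.Adj x y → c x ≠ c y := by
  classical
  have : NeZero d := ⟨by omega⟩
  obtain ⟨Φ, hΦ⟩ := exists_orbitEnum G hGmeas d hdeg
  obtain ⟨Y, hYm, hY, c₁, hc₁m, hc₁⟩ := exists_measurable_coloring_of_extendable hΦ hGmeas hdeg
  have hYr : ∀ x y, G.Reachable x y → y ∈ Y → x ∈ Y := by
    intro x y hxy hy
    obtain ⟨S, hS, hne, hSr, hext⟩ := (hY y).1 hy
    exact (hY x).2 ⟨S, hS, hne, fun z hz => hxy.trans (hSr z hz), hext⟩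
  have hU : Hard G d Yᶜ :=
    ⟨fun x hx y hxy hy => hx (hYr x y hxy hy),
      fun x hx S hS hne hSr hext => hx ((hY x).2 ⟨S, hS, hne, hSr, hext⟩)⟩
  obtain ⟨M, hM, hMinv, c₂, hc₂m, hc₂⟩ :=
    hU.exists_measurable_coloring hΦ hGmeas hd hdeg hclique hYm.compl μ
  obtain ⟨c₃, hc₃⟩ := hU.exists_coloring hd hdeg hclique
  refine ⟨fun x => if x ∈ Y then c₁ x else if x ∈ M then c₃ x else c₂ x, ?_, fun x y hxy => ?_⟩
  · refine NullMeasurable.congr (f := fun x => if x ∈ Y then c₁ x else c₂ x)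
      (Measurable.ite hYm hc₁m hc₂m).nullMeasurable ?_
    filter_upwards [measure_eq_zero_iff_ae_notMem.1 hM] with x hx
    simp only [if_neg hx]
  · have hYy : y ∈ Y ↔ x ∈ Y := ⟨hYr x y hxy.reachable, hYr y x hxy.symm.reachable⟩
    have hMy : y ∈ M ↔ x ∈ M := ⟨hMinv y x hxy.symm, hMinv x y hxy⟩
    simp only [hYy, hMy]
    split_ifs with h1 h2
    · exact hc₁ x y hxy h1
    · exact hc₃ x y hxy h1
    · exact hc₂ x y hxy h1 h2
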